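/- Consider the full DPPD dynamics with line-limit constraints: let κ ∈ (0,1), assume Slater's condition, and let η, d, ω, μ, θ̂ : [0,∞) → ℝⁿ and P, ν⁻, ν⁺ : [0,∞) → ℝˡ be continuously differentiable, with d(0) ∈ Ω, satisfying for all t ≥ 0, with u₁ = P^in − d − Dω − CP, u₂ = P^in − d − C B Cᵀ θ̂, p⁻ = max(0, ν⁻ + P̲ − B Cᵀ θ̂) (componentwise), p⁺ = max(0, ν⁺ + B Cᵀ θ̂ − P̄) (componentwise): η′ᵢ = prox_{f_{i,2}}(dᵢ − κηᵢ) − dᵢ; d′ᵢ = proj_{Ωᵢ}(dᵢ − f_{i,0}'(dᵢ) + κηᵢ + ωᵢ + u₁ᵢ + μᵢ + u₂ᵢ) − dᵢ; θ̂′ = C B (p⁻ − p⁺) + C B Cᵀ(μ + u₂); P′ = Cᵀ(ω + u₁); ω′ = (1/2)u₁; μ′ = (1/2)u₂; ν⁻′ = (1/2)(p⁻ − ν⁻); ν⁺′ = (1/2)(p⁺ − ν⁺). Then the trajectory (η, d, θ̂, P, ω, μ, ν⁻, ν⁺) converges as t → ∞ to an equilibrium of the system (a point where all right-hand sides vanish),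 and at this equilibrium ω* = 0 and (d*, θ̂*, ω*, P*) is an optimal solution of the ROLC problem. -/

import Mathlib

open Matrix Filter

namespace DPPD

structure Net (n l : ℕ) where
  C : Matrix (Fin n) (Fin l) ℝ
  M : Matrix (Fin l) (Fin n) ℝ
  L : Matrix (Fin n) (Fin n) ℝ
  hL : L = C * M
  hLt : Lᵀ = L
  Dg : Fin n → ℝ
  hD : ∀ i, 0 < Dg i
  Pin : Fin n → ℝ
  dlo : Fin n → ℝ
  dhi : Fin n → ℝ
  f0 : Fin n → ℝ → ℝ
  hf0 : ∀ i, Differentiable ℝ (f0 i)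
  β : ℝ
  hβ : 1 < β
  hsc : ∀ (i : Fin n) (x y : ℝ),
      f0 i x + deriv (f0 i) x * (y - x) + β / 2 * (y - x) ^ 2 ≤ f0 i y
  f2 : Fin n → ℝ → ℝ
  hf2 : ∀ i, ConvexOn ℝ Set.univ (f2 i)
  Plo : Fin l → ℝ
  Phi : Fin l → ℝ
  κ : ℝ
  hκ : κ ∈ Set.Ioo (0:ℝ) 1

/-- States: `z.1 = (η, d, θ, ω, μ)`, `z.2 = (P, ν⁻, ν⁺)`. -/
abbrev E (n l : ℕ) := (Fin 5 → Fin n → ℝ) × (Fin 3 → Fin l → ℝ)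

variable {n l : ℕ}

def u1 (N : Net n l) (z : E n l) (i : Fin n) : ℝ :=
  N.Pin i - z.1 1 i - N.Dg i * z.1 3 i - (N.C *ᵥ z.2 0) i
def u2 (N : Net n l) (z : E n l) (i : Fin n) : ℝ :=
  N.Pin i - z.1 1 i - (N.L *ᵥ z.1 2) i
def pm (N : Net n l) (z : E n l) (e : Fin l) : ℝ :=
  max 0 (z.2 1 e + N.Plo e - (N.M *ᵥ z.1 2) e)
def pp (N : Net n l) (z : E n l) (e : Fin l) : ℝ :=
  max 0 (z.2 2 e + (N.M *ᵥ z.1 2) e - N.Phi e)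

/-- `w` is the velocity of the dynamics at `z`. -/
structure Dyn (N : Net n l) (z w : E n l) : Prop where
  hη : ∀ i x, N.f2 i (w.1 0 i + z.1 1 i)
      + (-N.κ * z.1 0 i - w.1 0 i) * (x - (w.1 0 i + z.1 1 i)) ≤ N.f2 i x
  hdm : ∀ i, w.1 1 i + z.1 1 i ∈ Set.Icc (N.dlo i) (N.dhi i)
  hd : ∀ i, ∀ y ∈ Set.Icc (N.dlo i) (N.dhi i),
      (w.1 1 i + deriv (N.f0 i) (z.1 1 i) - N.κ * z.1 0 i - z.1 3 i - u1 N z i - z.1 4 i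
        - u2 N z i) * (w.1 1 i + z.1 1 i - y) ≤ 0
  hθ : ∀ i, w.1 2 i = (N.Mᵀ *ᵥ (pm N z - pp N z)) i + (N.L *ᵥ (z.1 4 + u2 N z)) i
  hω : ∀ i, w.1 3 i = 1 / 2 * u1 N z i
  hμ : ∀ i, w.1 4 i = 1 / 2 * u2 N z i
  hP : ∀ e, w.2 0 e = (N.Cᵀ *ᵥ (z.1 3 + u1 N z)) e
  hm : ∀ e, w.2 1 e = 1 / 2 * (pm N z e - z.2 1 e)
  hp : ∀ e, w.2 2 e = 1 / 2 * (pp N z e - z.2 2 e)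

/-! ### scalar facts -/

lemma node_ineq {κ β D η d ω μ η' d' u1 u2 g α bb : ℝ} (hκ0 : 0 < κ) (_hκ1 : κ < 1) (hβ : 1 < β)
    (hD : 0 < D) (hu1 : u1 = -d - D * ω - α) (hu2 : u2 = -d - bb)
    (hVI : (d' + g - κ * η - ω - u1 - μ - u2) * (d' + d) ≤ 0)
    (hpr : 0 ≤ (-κ * η - η') * (η' + d)) (hsc : β * d ^ 2 ≤ g * d) (a b : ℝ) :
    g * d' + d * d' - κ * (η' * d + η * d') + κ * η * η' + 2 * ω * (1/2*u1) + (1/2*u1) * u1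
      + ω * (-d' - D * (1/2*u1) - a) + u1 * (-d' - D * (1/2*u1) - a) + 2 * D * ω * (1/2*u1)
      + 2 * μ * (1/2*u2) + (1/2*u2) * u2 + μ * (-d' - b) + u2 * (-d' - b)
    ≤ -((1 - (1+κ)^2/4) * (η'^2 + d'^2 + (1/2*u1)^2 + (1/2*u2)^2))
      - (ω + u1) * a - (ω + u1) * α - (μ + u2) * b - (μ + u2) * bb := by
  obtain rfl : α = -d - D * ω - u1 := by linarith
  obtain rfl : bb = -d - u2 := by linarith
  have h1 : 0 ≤ (d + (1+κ)/2 * η')^2 := sq_nonneg _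
  have h2 : 0 ≤ (β - 1) * d^2 := mul_nonneg (by linarith) (sq_nonneg _)
  have h3 : 0 ≤ D * ((ω + u1/4)^2 + 7/16 * u1^2) := by positivity
  have h4 : 0 ≤ (1+κ)^2/4 * (d'^2 + (1/2*u1)^2 + (1/2*u2)^2) := by positivity
  have h5 : 0 ≤ u1^2 := sq_nonneg _
  have h6 : 0 ≤ u2^2 := sq_nonneg _
  nlinarith [h1, h2, h3, h4, h5, h6]

lemma max_firm (s s' : ℝ) : (max 0 s - max 0 s')^2 ≤ (max 0 s - max 0 s') * (s - s') := by
  rcases le_total 0 s with h | h <;> rcases le_total 0 s' with h' | h' <;>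
    simp [h, h'] <;> nlinarith

lemma edge_ineq {p ν ν' s m κ : ℝ} (hν : ν' = 1/2 * (p - ν)) (hs : s = ν - m)
    (hf : p^2 ≤ p * s) :
    ν * ν' + p * ν' ≤ -((1 - (1+κ)^2/4) * ν'^2) - p * m := by
  subst hs
  have h4 : 0 ≤ (1+κ)^2/4 * ν'^2 := by positivity
  have : p = 2 * ν' + ν := by linarith
  subst this
  nlinarith [sq_nonneg ν']

lemma breg_nonneg (s s' : ℝ) :
    0 ≤ 1/2 * (max 0 s)^2 - 1/2 * (max 0 s')^2 - max 0 s' * (s - s') := by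
  rcases le_total 0 s with h | h <;> rcases le_total 0 s' with h' | h' <;>
    simp [h, h'] <;> nlinarith [sq_nonneg (s-s')]

lemma hasDeriv_maxsq (s : ℝ) : HasDerivAt (fun s : ℝ => 1/2 * (max 0 s)^2) (max 0 s) s := by
  rcases lt_trichotomy s 0 with h | h | h
  · have : HasDerivAt (fun _ : ℝ => (0:ℝ)) (max 0 s) s := by
      rw [max_eq_left h.le]; exact hasDerivAt_const _ _
    refine this.congr_of_eventuallyEq ?_
    filter_upwards [Iio_mem_nhds h] with x hx
    simp [max_eq_left (le_of_lt (show x < 0 from hx))]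
  · subst h
    simp only [max_self]
    rw [hasDerivAt_iff_isLittleO]
    simp only [max_self]
    have : (fun x : ℝ => x^2) =o[nhds 0] (fun x : ℝ => x) := by
      simpa using Asymptotics.isLittleO_pow_id (𝕜 := ℝ) (n := 2) (by norm_num)
    refine (Asymptotics.IsBigO.of_bound 1 (Eventually.of_forall fun x => ?_)).trans_isLittleO
      (this.congr_right (fun x => by simp))
    rcases le_total 0 x with h | h
    · simp [h]; nlinarith [sq_nonneg x]
    · simp [h]; positivity
  · have : HasDerivAt (fun s : ℝ => 1/2 * s^2) (max 0 s) s := by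
      rw [max_eq_right h.le]
      have := ((hasDerivAt_id' s).fun_pow 2).const_mul (1/2)
      exact this.congr_deriv (by simp)
    refine this.congr_of_eventuallyEq ?_
    filter_upwards [Ioi_mem_nhds h] with x hx
    simp [max_eq_right (le_of_lt (show 0 < x from hx))]

lemma clamp_iff {lo hi x r : ℝ} (h : lo ≤ hi) :
    r = max lo (min hi x) ↔ r ∈ Set.Icc lo hi ∧ ∀ y ∈ Set.Icc lo hi, (r - x) * (r - y) ≤ 0 := by
  constructor
  · rintro rfl
    refine ⟨⟨le_max_left _ _, max_le h (min_le_left _ _)⟩, fun y hy => ?_⟩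
    obtain ⟨h1, h2⟩ := hy
    rcases le_total hi x with h3 | h3
    · rw [min_eq_left h3, max_eq_right h]; nlinarith
    · rw [min_eq_right h3]
      rcases le_total lo x with h4 | h4
      · rw [max_eq_right h4]; simp
      · rw [max_eq_left h4]; nlinarith
  · rintro ⟨⟨h1, h2⟩, hy⟩
    have h3 := hy (max lo (min hi x)) ⟨le_max_left _ _, max_le h (min_le_left _ _)⟩
    rcases le_total hi x with h4 | h4
    · rw [min_eq_left h4, max_eq_right h] at h3 ⊢
      by_contra hne
      have : r < hi := lt_of_le_of_ne h2 hne
      nlinarith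
    · rw [min_eq_right h4] at h3 ⊢
      rcases le_total lo x with h5 | h5
      · rw [max_eq_right h5] at h3 ⊢
        nlinarith
      · rw [max_eq_left h5] at h3 ⊢
        by_contra hne
        have : lo < r := lt_of_le_of_ne h1 (Ne.symm hne)
        nlinarith

lemma prox_iff {f : ℝ → ℝ} (hf : ConvexOn ℝ Set.univ f) (y ξ : ℝ) :
    IsMinOn (fun x : ℝ => f x + (1 / 2) * (x - y) ^ 2) Set.univ ξ ↔
      ∀ x, f ξ + (y - ξ) * (x - ξ) ≤ f x := by
  rw [isMinOn_univ_iff]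
  constructor
  · intro h x
    have key : ∀ s : ℝ, 0 < s → s < 1 →
        f ξ + (y - ξ) * (x - ξ) ≤ f x + s * (1/2 * (x - ξ)^2) := by
      intro s hs hs1
      have h1 := h (ξ + s * (x - ξ))
      have h2 := hf.2 (Set.mem_univ ξ) (Set.mem_univ x) (show (0:ℝ) ≤ 1 - s by linarith) hs.le
        (by ring)
      simp only [smul_eq_mul] at h2
      have h3 : (1 - s) * ξ + s * x = ξ + s * (x - ξ) := by ring
      rw [h3] at h2
      have : s * (f ξ + (y - ξ) * (x - ξ)) ≤ s * (f x + s * (1/2 * (x - ξ)^2)) := by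
        nlinarith
      exact le_of_mul_le_mul_left this hs
    have ht : Tendsto (fun s : ℝ => f x + s * (1/2 * (x - ξ)^2)) (nhdsWithin 0 (Set.Ioi 0))
        (nhds (f x)) := by
      have : Continuous (fun s : ℝ => f x + s * (1/2 * (x - ξ)^2)) := by fun_prop
      simpa using (this.tendsto 0).mono_left nhdsWithin_le_nhds
    refine ge_of_tendsto ht ?_
    filter_upwards [Ioo_mem_nhdsGT (show (0:ℝ) < 1 by norm_num)] with s hs
    exact key s hs.1 hs.2
  · intro h x
    have := h x
    nlinarith [sq_nonneg (x - ξ)]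

lemma deriv_mono (N : Net n l) (i : Fin n) (x y : ℝ) :
    N.β * (x - y)^2 ≤ (deriv (N.f0 i) x - deriv (N.f0 i) y) * (x - y) := by
  have h1 := N.hsc i x y
  have h2 := N.hsc i y x
  nlinarith

lemma deriv_cont (N : Net n l) (i : Fin n) : Continuous (deriv (N.f0 i)) := by
  have hβ := N.hβ
  have hmono : Monotone (deriv (N.f0 i)) := by
    intro x y hxy
    rcases hxy.eq_or_lt with rfl | h
    · exact le_rfl
    have := deriv_mono N i y x
    have h2 : 0 ≤ (deriv (N.f0 i) y - deriv (N.f0 i) x) * (y - x) := le_trans (by positivity) this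
    have := nonneg_of_mul_nonneg_left h2 (by linarith)
    linarith
  have hst : ∀ x y, x < y → (y - x) ≤ deriv (N.f0 i) y - deriv (N.f0 i) x := by
    intro x y h
    have := deriv_mono N i y x
    have h3 : (y-x) * (y - x) ≤ (deriv (N.f0 i) y - deriv (N.f0 i) x) * (y - x) := by
      nlinarith [sq_nonneg (y-x)]
    exact le_of_mul_le_mul_right h3 (by linarith)
  refine hmono.continuous_of_surjective ?_
  have hoc : (Set.univ.image (deriv (N.f0 i))).OrdConnected :=
    Set.ordConnected_univ.image_deriv (fun x _ => N.hf0 i x)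
  intro v
  have hb := hst 0 (|v - deriv (N.f0 i) 0| + 1) (by positivity)
  have ha := hst (-(|v - deriv (N.f0 i) 0| + 1)) 0 (by linarith [abs_nonneg (v - deriv (N.f0 i) 0)])
  have := hoc.out (Set.mem_image_of_mem _ (Set.mem_univ (-(|v - deriv (N.f0 i) 0| + 1))))
    (Set.mem_image_of_mem _ (Set.mem_univ ((|v - deriv (N.f0 i) 0| + 1))))
    (show v ∈ Set.Icc _ _ from ⟨by linarith [neg_abs_le (v - deriv (N.f0 i) 0)],
      by linarith [le_abs_self (v - deriv (N.f0 i) 0)]⟩)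
  obtain ⟨x, -, hx⟩ := this
  exact ⟨x, hx⟩

lemma f2_cont (N : Net n l) (i : Fin n) : Continuous (N.f2 i) := by
  have := (N.hf2 i).continuousOn isOpen_univ
  exact continuousOn_univ.1 this

end DPPD

namespace DPPD

variable {n l : ℕ}

/-- Node part of the Lyapunov function. -/
noncomputable def Vn (N : Net n l) (zs z : E n l) (i : Fin n) : ℝ :=
  (N.f0 i (z.1 1 i) - N.f0 i (zs.1 1 i) - deriv (N.f0 i) (zs.1 1 i) * (z.1 1 i - zs.1 1 i))
  + 1/2 * (z.1 1 i - zs.1 1 i)^2 - N.κ * ((z.1 0 i - zs.1 0 i) * (z.1 1 i - zs.1 1 i))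
  + N.κ/2 * (z.1 0 i - zs.1 0 i)^2
  + ((z.1 3 i - zs.1 3 i)^2 + (z.1 3 i - zs.1 3 i) * u1 N z i + 1/2 * (u1 N z i)^2
    + N.Dg i * (z.1 3 i - zs.1 3 i)^2)
  + ((z.1 4 i - zs.1 4 i)^2 + (z.1 4 i - zs.1 4 i) * u2 N z i + 1/2 * (u2 N z i)^2)
  + 1/2 * (z.1 2 i - zs.1 2 i)^2

def sm (N : Net n l) (z : E n l) (e : Fin l) : ℝ := z.2 1 e + N.Plo e - (N.M *ᵥ z.1 2) e
def sp (N : Net n l) (z : E n l) (e : Fin l) : ℝ := z.2 2 e + (N.M *ᵥ z.1 2) e - N.Phi e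

/-- Edge part of the Lyapunov function. -/
noncomputable def Ve (N : Net n l) (zs z : E n l) (e : Fin l) : ℝ :=
  1/2 * (z.2 0 e - zs.2 0 e)^2 + 1/2 * (z.2 1 e - zs.2 1 e)^2 + 1/2 * (z.2 2 e - zs.2 2 e)^2
  + (1/2 * (max 0 (sm N z e))^2 - 1/2 * (max 0 (sm N zs e))^2
      - max 0 (sm N zs e) * (sm N z e - sm N zs e))
  + (1/2 * (max 0 (sp N z e))^2 - 1/2 * (max 0 (sp N zs e))^2
      - max 0 (sp N zs e) * (sp N z e - sp N zs e))

noncomputable def V (N : Net n l) (zs z : E n l) : ℝ :=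
  ∑ i, Vn N zs z i + ∑ e, Ve N zs z e

lemma cont_u1 (N : Net n l) (i : Fin n) : Continuous fun z => u1 N z i := by
  unfold u1 Matrix.mulVec dotProduct
  fun_prop
lemma cont_u2 (N : Net n l) (i : Fin n) : Continuous fun z => u2 N z i := by
  unfold u2 Matrix.mulVec dotProduct
  fun_prop
lemma cont_sm (N : Net n l) (i : Fin l) : Continuous fun z => sm N z i := by
  unfold sm Matrix.mulVec dotProduct
  fun_prop
lemma cont_sp (N : Net n l) (i : Fin l) : Continuous fun z => sp N z i := by
  unfold sp Matrix.mulVec dotProduct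
  fun_prop

lemma V_cont (N : Net n l) (zs : E n l) : Continuous (V N zs) := by
  have h1 := cont_u1 N
  have h2 := cont_u2 N
  have h3 := cont_sm N
  have h4 := cont_sp N
  have h5 : ∀ i, Continuous (N.f0 i) := fun i => (N.hf0 i).continuous
  unfold V Vn Ve
  fun_prop

lemma V_self (N : Net n l) (zs : E n l) (h : Dyn N zs 0) : V N zs zs = 0 := by
  have h1 : ∀ i, u1 N zs i = 0 := fun i => by have := h.hω i; simp at this; linarith
  have h2 : ∀ i, u2 N zs i = 0 := fun i => by have := h.hμ i; simp at this; linarith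
  unfold V Vn Ve
  simp [h1, h2]

lemma V_coer (N : Net n l) (zs z : E n l) :
    N.κ / 8 * (∑ j, ∑ i, (z.1 j i - zs.1 j i)^2 + ∑ j, ∑ e, (z.2 j e - zs.2 j e)^2) ≤ V N zs z := by
  obtain ⟨hκ0, hκ1⟩ := N.hκ
  have hβ := N.hβ
  unfold V
  rw [mul_add, Finset.sum_comm, Finset.sum_comm (s := (Finset.univ : Finset (Fin 3))),
    Finset.mul_sum, Finset.mul_sum]
  refine add_le_add (Finset.sum_le_sum fun i _ => ?_) (Finset.sum_le_sum fun e _ => ?_)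
  · have hs := N.hsc i (zs.1 1 i) (z.1 1 i)
    have hD := N.hD i
    rw [Fin.sum_univ_five]
    unfold Vn
    generalize N.f0 i (z.1 1 i) = F at *
    generalize N.f0 i (zs.1 1 i) = F' at *
    generalize deriv (N.f0 i) (zs.1 1 i) = G at *
    generalize u1 N z i = a
    generalize u2 N z i = b
    generalize z.1 0 i - zs.1 0 i = η
    generalize z.1 1 i - zs.1 1 i = d at *
    generalize z.1 2 i - zs.1 2 i = θ
    generalize z.1 3 i - zs.1 3 i = ω
    generalize z.1 4 i - zs.1 4 i = μ
    generalize N.κ = κ at *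
    have e1 : 1/2 * d^2 ≤ F - F' - G * d := by nlinarith [sq_nonneg d]
    have e2 : κ/8 * ω^2 ≤ ω^2 + ω * a + 1/2 * a^2 + N.Dg i * ω^2 := by
      have : 0 ≤ N.Dg i * ω^2 := by positivity
      nlinarith [sq_nonneg (ω + a), sq_nonneg ω]
    have e3 : κ/8 * μ^2 ≤ μ^2 + μ * b + 1/2 * b^2 := by
      nlinarith [sq_nonneg (μ + b), sq_nonneg μ]
    have e4 : κ/8 * θ^2 ≤ 1/2 * θ^2 := by nlinarith [sq_nonneg θ]
    have e5 : κ/8 * (η^2 + d^2) ≤ d^2 - κ * (η * d) + κ/2 * η^2 := by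
      have a1 : 0 ≤ κ * (3/8 * (η - 4/3*d)^2) := by positivity
      have a2 : 0 ≤ (1 - κ) * d^2 := mul_nonneg (by linarith) (sq_nonneg _)
      nlinarith [sq_nonneg d]
    linarith
  · rw [Fin.sum_univ_three]
    unfold Ve
    have b1 := breg_nonneg (sm N z e) (sm N zs e)
    have b2 := breg_nonneg (sp N z e) (sp N zs e)
    have q : ∀ x : ℝ, N.κ/8 * x^2 ≤ 1/2 * x^2 := fun x => by nlinarith [sq_nonneg x]
    have := q (z.2 0 e - zs.2 0 e)
    have := q (z.2 1 e - zs.2 1 e)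
    have := q (z.2 2 e - zs.2 2 e)
    linarith

/-- The derivative of the node part. -/
noncomputable def dVn (N : Net n l) (zs z w : E n l) (i : Fin n) : ℝ :=
  (deriv (N.f0 i) (z.1 1 i) - deriv (N.f0 i) (zs.1 1 i)) * w.1 1 i
   + (z.1 1 i - zs.1 1 i) * w.1 1 i
   - N.κ * (w.1 0 i * (z.1 1 i - zs.1 1 i) + (z.1 0 i - zs.1 0 i) * w.1 1 i)
   + N.κ * (z.1 0 i - zs.1 0 i) * w.1 0 i
   + 2 * (z.1 3 i - zs.1 3 i) * w.1 3 i + w.1 3 i * u1 N z i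
   + (z.1 3 i - zs.1 3 i) * (-w.1 1 i - N.Dg i * w.1 3 i - (N.C *ᵥ w.2 0) i)
   + u1 N z i * (-w.1 1 i - N.Dg i * w.1 3 i - (N.C *ᵥ w.2 0) i)
   + 2 * N.Dg i * (z.1 3 i - zs.1 3 i) * w.1 3 i
   + 2 * (z.1 4 i - zs.1 4 i) * w.1 4 i + w.1 4 i * u2 N z i
   + (z.1 4 i - zs.1 4 i) * (-w.1 1 i - (N.L *ᵥ w.1 2) i)
   + u2 N z i * (-w.1 1 i - (N.L *ᵥ w.1 2) i)
   + (z.1 2 i - zs.1 2 i) * w.1 2 i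

noncomputable def dVe (N : Net n l) (zs z w : E n l) (e : Fin l) : ℝ :=
  (z.2 0 e - zs.2 0 e) * w.2 0 e + (z.2 1 e - zs.2 1 e) * w.2 1 e
  + (z.2 2 e - zs.2 2 e) * w.2 2 e
  + (pm N z e - pm N zs e) * (w.2 1 e - (N.M *ᵥ w.1 2) e)
  + (pp N z e - pp N zs e) * (w.2 2 e + (N.M *ᵥ w.1 2) e)

lemma hasDeriv_mulVec {a b : ℕ} (A : Matrix (Fin a) (Fin b) ℝ) (x : ℝ → Fin b → ℝ) (x' : Fin b → ℝ)
    (s : Set ℝ) (t : ℝ) (h : ∀ i, HasDerivWithinAt (fun t => x t i) (x' i) s t) (i : Fin a) :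
    HasDerivWithinAt (fun t => (A *ᵥ x t) i) ((A *ᵥ x') i) s t := by
  unfold Matrix.mulVec dotProduct
  exact HasDerivWithinAt.fun_sum fun j _ => (h j).const_mul _

lemma V_deriv (N : Net n l) (zs : E n l) (z : ℝ → E n l) (w : E n l) (s : Set ℝ) (t : ℝ)
    (h1 : ∀ j i, HasDerivWithinAt (fun t => (z t).1 j i) (w.1 j i) s t)
    (h2 : ∀ j i, HasDerivWithinAt (fun t => (z t).2 j i) (w.2 j i) s t) :
    HasDerivWithinAt (fun t => V N zs (z t)) (∑ i, dVn N zs (z t) w i + ∑ e, dVe N zs (z t) w e)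
      s t := by
  have hu1 : ∀ i, HasDerivWithinAt (fun t => u1 N (z t) i)
      (-w.1 1 i - N.Dg i * w.1 3 i - (N.C *ᵥ w.2 0) i) s t := fun i => by
    have := (((h1 1 i).const_sub (N.Pin i)).sub ((h1 3 i).const_mul (N.Dg i))).sub
      (hasDeriv_mulVec N.C (fun t => (z t).2 0) (w.2 0) s t (h2 0) i)
    exact this
  have hu2 : ∀ i, HasDerivWithinAt (fun t => u2 N (z t) i)
      (-w.1 1 i - (N.L *ᵥ w.1 2) i) s t := fun i => by
    have := ((h1 1 i).const_sub (N.Pin i)).sub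
      (hasDeriv_mulVec N.L (fun t => (z t).1 2) (w.1 2) s t (h1 2) i)
    exact this
  have hsm : ∀ e, HasDerivWithinAt (fun t => sm N (z t) e)
      (w.2 1 e - (N.M *ᵥ w.1 2) e) s t := fun e =>
    ((h2 1 e).add_const (N.Plo e)).sub
      (hasDeriv_mulVec N.M (fun t => (z t).1 2) (w.1 2) s t (h1 2) e)
  have hsp : ∀ e, HasDerivWithinAt (fun t => sp N (z t) e)
      (w.2 2 e + (N.M *ᵥ w.1 2) e) s t := fun e =>
    ((h2 2 e).add (hasDeriv_mulVec N.M (fun t => (z t).1 2) (w.1 2) s t (h1 2) e)).sub_const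
      (N.Phi e)
  have sq : ∀ {f : ℝ → ℝ} {f' : ℝ}, HasDerivWithinAt f f' s t →
      HasDerivWithinAt (fun t => (f t)^2) (2 * f t * f') s t := fun hf => by
    have := hf.fun_pow 2
    simpa using this
  unfold V
  refine HasDerivWithinAt.fun_add (HasDerivWithinAt.fun_sum fun i _ => ?_)
    (HasDerivWithinAt.fun_sum fun e _ => ?_)
  · unfold Vn
    have a0 := (h1 0 i).sub_const (zs.1 0 i)
    have a1 := (h1 1 i).sub_const (zs.1 1 i)
    have a2 := (h1 2 i).sub_const (zs.1 2 i)
    have a3 := (h1 3 i).sub_const (zs.1 3 i)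
    have a4 := (h1 4 i).sub_const (zs.1 4 i)
    have af := ((N.hf0 i ((z t).1 1 i)).hasDerivAt).comp_hasDerivWithinAt t (h1 1 i)
    have b1 := (af.sub_const (N.f0 i (zs.1 1 i))).fun_sub
      (a1.const_mul (deriv (N.f0 i) (zs.1 1 i)))
    have b2 := (((b1.fun_add ((sq a1).const_mul (1/2))).fun_sub ((a0.fun_mul a1).const_mul N.κ)).fun_add
      ((sq a0).const_mul (N.κ/2)))
    have b3 := (((sq a3).fun_add (a3.fun_mul (hu1 i))).fun_add ((sq (hu1 i)).const_mul (1/2))).fun_add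
      ((sq a3).const_mul (N.Dg i))
    have b4 := (((sq a4).fun_add (a4.fun_mul (hu2 i))).fun_add ((sq (hu2 i)).const_mul (1/2)))
    have b5 := ((b2.fun_add b3).fun_add b4).fun_add ((sq a2).const_mul (1/2))
    refine (b5.congr_deriv ?_)
    unfold dVn
    ring
  · unfold Ve
    have a0 := (h2 0 e).sub_const (zs.2 0 e)
    have a1 := (h2 1 e).sub_const (zs.2 1 e)
    have a2 := (h2 2 e).sub_const (zs.2 2 e)
    have c1 := (hasDeriv_maxsq (sm N (z t) e)).comp_hasDerivWithinAt t (hsm e)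
    have c2 := (hasDeriv_maxsq (sp N (z t) e)).comp_hasDerivWithinAt t (hsp e)
    have d1 := (c1.sub_const (1/2 * (max 0 (sm N zs e))^2)).fun_sub
      (((hsm e).sub_const (sm N zs e)).const_mul (max 0 (sm N zs e)))
    have d2 := (c2.sub_const (1/2 * (max 0 (sp N zs e))^2)).fun_sub
      (((hsp e).sub_const (sp N zs e)).const_mul (max 0 (sp N zs e)))
    have b := (((((sq a0).const_mul (1/2)).fun_add ((sq a1).const_mul (1/2))).fun_add
      ((sq a2).const_mul (1/2))).fun_add d1).fun_add d2
    refine (b.congr_deriv ?_)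
    unfold dVe pm pp sm sp
    ring

lemma V_decay (N : Net n l) (zs z w : E n l) (hs : Dyn N zs 0) (h : Dyn N z w) :
    ∑ i, dVn N zs z w i + ∑ e, dVe N zs z w e ≤
      -((1 - (1+N.κ)^2/4) * (∑ j, ∑ i, (w.1 j i)^2 + ∑ j, ∑ e, (w.2 j e)^2)) := by
  obtain ⟨hκ0, hκ1⟩ := N.hκ
  have hβ := N.hβ
  have hu1s : ∀ i, u1 N zs i = 0 := fun i => by have := hs.hω i; simp at this; linarith
  have hu2s : ∀ i, u2 N zs i = 0 := fun i => by have := hs.hμ i; simp at this; linarith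
  have hu1s' : u1 N zs = 0 := funext hu1s
  have hu2s' : u2 N zs = 0 := funext hu2s
  set x1 : Fin n → ℝ := (z.1 3 - zs.1 3) + u1 N z with hx1
  set x2 : Fin n → ℝ := (z.1 4 - zs.1 4) + u2 N z with hx2
  set p : Fin l → ℝ := (pm N z - pp N z) - (pm N zs - pp N zs) with hp
  set Pt : Fin l → ℝ := z.2 0 - zs.2 0 with hPt
  set θt : Fin n → ℝ := z.1 2 - zs.1 2 with hθt
  have hPP : w.2 0 = N.Cᵀ *ᵥ x1 := by
    have e1 : w.2 0 = N.Cᵀ *ᵥ (z.1 3 + u1 N z) := funext h.hP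
    have e2 : (0 : Fin l → ℝ) = N.Cᵀ *ᵥ (zs.1 3 + u1 N zs) := funext hs.hP
    have : x1 = (z.1 3 + u1 N z) - (zs.1 3 + u1 N zs) := by rw [hu1s', hx1]; abel
    rw [this, mulVec_sub, ← e2, e1, sub_zero]
  have hθθ : w.1 2 = N.Mᵀ *ᵥ p + N.L *ᵥ x2 := by
    have e1 : w.1 2 = N.Mᵀ *ᵥ (pm N z - pp N z) + N.L *ᵥ (z.1 4 + u2 N z) := funext h.hθ
    have e2 : (0 : Fin n → ℝ) = N.Mᵀ *ᵥ (pm N zs - pp N zs) + N.L *ᵥ (zs.1 4 + u2 N zs) :=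
      funext hs.hθ
    have : x2 = (z.1 4 + u2 N z) - (zs.1 4 + u2 N zs) := by rw [hu2s', hx2]; abel
    rw [this, hp, mulVec_sub _ (pm N z - pp N z), mulVec_sub _ (z.1 4 + u2 N z)]
    calc w.1 2 = w.1 2 - 0 := by simp
      _ = _ := by rw [e2, e1]; abel
  -- cross identities
  have adj : ∀ {a b : ℕ} (A : Matrix (Fin a) (Fin b) ℝ) (x : Fin a → ℝ) (y : Fin b → ℝ),
      x ⬝ᵥ (A *ᵥ y) = (Aᵀ *ᵥ x) ⬝ᵥ y := fun A x y => by
    rw [dotProduct_mulVec, mulVec_transpose]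
  have c1 : x1 ⬝ᵥ (N.C *ᵥ w.2 0) = w.2 0 ⬝ᵥ w.2 0 := by
    rw [adj, ← hPP]
  have c2 : x1 ⬝ᵥ (N.C *ᵥ Pt) = Pt ⬝ᵥ w.2 0 := by
    rw [adj, ← hPP, dotProduct_comm]
  have c34 : ∀ y : Fin n → ℝ, x2 ⬝ᵥ (N.L *ᵥ y) = y ⬝ᵥ w.1 2 - p ⬝ᵥ (N.M *ᵥ y) := by
    intro y
    rw [adj, N.hLt, adj, hθθ, dotProduct_add, dotProduct_comm y, dotProduct_comm y]
    ring
  have c3 := c34 (w.1 2)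
  have c4 := c34 θt
  have hnode : ∀ i, dVn N zs z w i ≤
      -((1 - (1+N.κ)^2/4) * ((w.1 0 i)^2 + (w.1 1 i)^2 + (w.1 3 i)^2 + (w.1 4 i)^2))
      - x1 i * (N.C *ᵥ w.2 0) i - x1 i * (N.C *ᵥ Pt) i - x2 i * (N.L *ᵥ w.1 2) i
      - x2 i * (N.L *ᵥ θt) i + θt i * w.1 2 i := by
    intro i
    have e1 : u1 N z i = -(z.1 1 i - zs.1 1 i) - N.Dg i * (z.1 3 i - zs.1 3 i)
        - (N.C *ᵥ Pt) i := by
      have := hu1s i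
      rw [hPt, mulVec_sub, Pi.sub_apply]
      unfold u1 at *
      linarith
    have e2 : u2 N z i = -(z.1 1 i - zs.1 1 i) - (N.L *ᵥ θt) i := by
      have := hu2s i
      rw [hθt, mulVec_sub, Pi.sub_apply]
      unfold u2 at *
      linarith
    have e3 : (w.1 1 i + (deriv (N.f0 i) (z.1 1 i) - deriv (N.f0 i) (zs.1 1 i))
        - N.κ * (z.1 0 i - zs.1 0 i) - (z.1 3 i - zs.1 3 i) - u1 N z i
        - (z.1 4 i - zs.1 4 i) - u2 N z i) * (w.1 1 i + (z.1 1 i - zs.1 1 i)) ≤ 0 := by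
      have a1 := h.hd i (zs.1 1 i) (by simpa using hs.hdm i)
      have a2 := hs.hd i _ (h.hdm i)
      simp only [hu1s, hu2s, Prod.fst_zero, Pi.zero_apply] at a2
      linarith
    have e4 : 0 ≤ (-N.κ * (z.1 0 i - zs.1 0 i) - w.1 0 i) * (w.1 0 i + (z.1 1 i - zs.1 1 i)) := by
      have a1 := h.hη i (zs.1 1 i)
      have a2 := hs.hη i (w.1 0 i + z.1 1 i)
      simp only [Prod.fst_zero, Pi.zero_apply, zero_add] at a2
      linarith
    have e5 := deriv_mono N i (z.1 1 i) (zs.1 1 i)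
    have := node_ineq hκ0 hκ1 hβ (N.hD i) e1 e2 e3 e4 e5 ((N.C *ᵥ w.2 0) i) ((N.L *ᵥ w.1 2) i)
    rw [← h.hω i, ← h.hμ i] at this
    unfold dVn
    simp only [hx1, hx2, Pi.add_apply, Pi.sub_apply]
    have t : θt i = z.1 2 i - zs.1 2 i := rfl
    rw [t]
    linarith
  have hedge : ∀ e, dVe N zs z w e ≤
      -((1 - (1+N.κ)^2/4) * ((w.2 1 e)^2 + (w.2 2 e)^2))
      + Pt e * w.2 0 e - p e * (N.M *ᵥ w.1 2) e - p e * (N.M *ᵥ θt) e := by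
    intro e
    have ms : zs.2 1 e = pm N zs e := by have := hs.hm e; simp at this; linarith
    have ps : zs.2 2 e = pp N zs e := by have := hs.hp e; simp at this; linarith
    have q1 : (N.M *ᵥ θt) e = (N.M *ᵥ z.1 2) e - (N.M *ᵥ zs.1 2) e := by
      rw [hθt, mulVec_sub, Pi.sub_apply]
    have f1 := max_firm (sm N z e) (sm N zs e)
    have f2 := max_firm (sp N z e) (sp N zs e)
    have i1 := edge_ineq (p := pm N z e - pm N zs e) (ν := z.2 1 e - zs.2 1 e) (ν' := w.2 1 e)
      (s := sm N z e - sm N zs e) (m := (N.M *ᵥ θt) e) (κ := N.κ)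
      (by rw [h.hm e, ms]; ring) (by rw [q1]; unfold sm; ring) f1
    have i2 := edge_ineq (p := pp N z e - pp N zs e) (ν := z.2 2 e - zs.2 2 e) (ν' := w.2 2 e)
      (s := sp N z e - sp N zs e) (m := -(N.M *ᵥ θt) e) (κ := N.κ)
      (by rw [h.hp e, ps]; ring) (by rw [q1]; unfold sp; ring) f2
    have pe : p e = (pm N z e - pp N z e) - (pm N zs e - pp N zs e) := rfl
    have t : Pt e = z.2 0 e - zs.2 0 e := rfl
    unfold dVe
    rw [pe, t]
    linarith
  have S1 := Finset.sum_le_sum (s := Finset.univ) fun i _ => hnode i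
  have S2 := Finset.sum_le_sum (s := Finset.univ) fun i _ => hedge i
  have sqd : ∀ {a : ℕ} (x : Fin a → ℝ), x ⬝ᵥ x = ∑ i, x i ^2 := fun x => by
    simp [dotProduct, sq]
  rw [sqd] at c1 c3
  simp only [Finset.sum_add_distrib, Finset.sum_sub_distrib, Finset.sum_neg_distrib,
    ← Finset.mul_sum] at S1 S2
  simp only [Fin.sum_univ_five, Fin.sum_univ_three]
  simp only [dotProduct] at c1 c2 c3 c4
  have g1 : 0 ≤ (1+N.κ)^2/4 * ∑ e, (w.2 0 e)^2 := by positivity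
  have g2 : 0 ≤ (1+N.κ)^2/4 * ∑ e, (w.1 2 e)^2 := by positivity
  linarith

end DPPD

namespace DPPD

variable {n l : ℕ}

lemma Dyn_closed (N : Net n l) (z w : ℕ → E n l) (z₀ w₀ : E n l) (h : ∀ k, Dyn N (z k) (w k))
    (hz : Tendsto z atTop (nhds z₀)) (hw : Tendsto w atTop (nhds w₀)) : Dyn N z₀ w₀ := by
  have hzw : Tendsto (fun k => (z k, w k)) atTop (nhds (z₀, w₀)) := hz.prodMk_nhds hw
  have lim : ∀ F : E n l × E n l → ℝ, Continuous F →
      Tendsto (fun k => F (z k, w k)) atTop (nhds (F (z₀, w₀))) := fun F hF =>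
    (hF.tendsto _).comp hzw
  have le0 : ∀ F G : E n l × E n l → ℝ, Continuous F → Continuous G →
      (∀ k, F (z k, w k) ≤ G (z k, w k)) → F (z₀, w₀) ≤ G (z₀, w₀) := fun F G hF hG hk =>
    le_of_tendsto_of_tendsto' (lim F hF) (lim G hG) hk
  have eq0 : ∀ F G : E n l × E n l → ℝ, Continuous F → Continuous G →
      (∀ k, F (z k, w k) = G (z k, w k)) → F (z₀, w₀) = G (z₀, w₀) := fun F G hF hG hk =>
    le_antisymm (le0 F G hF hG fun k => (hk k).le) (le0 G F hG hF fun k => (hk k).ge)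
  have k1 := cont_u1 N
  have k2 := cont_u2 N
  have k3 : ∀ e, Continuous fun z => pm N z e := fun e =>
    continuous_const.max (cont_sm N e)
  have k4 : ∀ e, Continuous fun z => pp N z e := fun e =>
    continuous_const.max (cont_sp N e)
  have k5 := deriv_cont N
  have k6 := f2_cont N
  constructor
  · intro i x
    exact le0 (fun q => N.f2 i (q.2.1 0 i + q.1.1 1 i)
      + (-N.κ * q.1.1 0 i - q.2.1 0 i) * (x - (q.2.1 0 i + q.1.1 1 i))) (fun _ => N.f2 i x)
      (by fun_prop) (by fun_prop) fun k => (h k).hη i x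
  · intro i
    exact ⟨le0 (fun _ => N.dlo i) (fun q => q.2.1 1 i + q.1.1 1 i) (by fun_prop) (by fun_prop)
        fun k => ((h k).hdm i).1,
      le0 (fun q => q.2.1 1 i + q.1.1 1 i) (fun _ => N.dhi i) (by fun_prop) (by fun_prop)
        fun k => ((h k).hdm i).2⟩
  · intro i y hy
    exact le0 (fun q => (q.2.1 1 i + deriv (N.f0 i) (q.1.1 1 i) - N.κ * q.1.1 0 i - q.1.1 3 i
        - u1 N q.1 i - q.1.1 4 i - u2 N q.1 i) * (q.2.1 1 i + q.1.1 1 i - y)) (fun _ => 0)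
      (by fun_prop) (by fun_prop) fun k => (h k).hd i y hy
  · intro i
    exact eq0 (fun q => q.2.1 2 i) (fun q => (N.Mᵀ *ᵥ (pm N q.1 - pp N q.1)) i
        + (N.L *ᵥ (q.1.1 4 + u2 N q.1)) i) (by fun_prop)
      (by simp only [Matrix.mulVec, dotProduct, Pi.sub_apply, Pi.add_apply]; fun_prop)
      fun k => (h k).hθ i
  · intro i
    exact eq0 (fun q => q.2.1 3 i) (fun q => 1/2 * u1 N q.1 i) (by fun_prop) (by fun_prop)
      fun k => (h k).hω i
  · intro i
    exact eq0 (fun q => q.2.1 4 i) (fun q => 1/2 * u2 N q.1 i) (by fun_prop) (by fun_prop)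
      fun k => (h k).hμ i
  · intro e
    exact eq0 (fun q => q.2.2 0 e) (fun q => (N.Cᵀ *ᵥ (q.1.1 3 + u1 N q.1)) e) (by fun_prop)
      (by simp only [Matrix.mulVec, dotProduct, Pi.add_apply]; fun_prop)
      fun k => (h k).hP e
  · intro e
    exact eq0 (fun q => q.2.2 1 e) (fun q => 1/2 * (pm N q.1 e - q.1.2 1 e)) (by fun_prop)
      (by fun_prop) fun k => (h k).hm e
  · intro e
    exact eq0 (fun q => q.2.2 2 e) (fun q => 1/2 * (pp N q.1 e - q.1.2 2 e)) (by fun_prop)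
      (by fun_prop) fun k => (h k).hp e

/-- Sum of squares. -/
def nsq (w : E n l) : ℝ := ∑ j, ∑ i, (w.1 j i)^2 + ∑ j, ∑ e, (w.2 j e)^2

lemma nsq_nonneg (w : E n l) : 0 ≤ nsq w := by unfold nsq; positivity

lemma le_nsq1 (w : E n l) (j i) : (w.1 j i)^2 ≤ nsq w := by
  have h1 : (w.1 j i)^2 ≤ ∑ i, (w.1 j i)^2 :=
    Finset.single_le_sum (f := fun i => (w.1 j i)^2) (fun _ _ => sq_nonneg _) (Finset.mem_univ i)
  have h2 : ∑ i, (w.1 j i)^2 ≤ ∑ j, ∑ i, (w.1 j i)^2 :=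
    Finset.single_le_sum (f := fun j => ∑ i, (w.1 j i)^2)
      (fun _ _ => Finset.sum_nonneg fun _ _ => sq_nonneg _) (Finset.mem_univ j)
  have h3 : 0 ≤ ∑ j, ∑ e, (w.2 j e)^2 := by positivity
  unfold nsq; linarith

lemma le_nsq2 (w : E n l) (j i) : (w.2 j i)^2 ≤ nsq w := by
  have h1 : (w.2 j i)^2 ≤ ∑ i, (w.2 j i)^2 :=
    Finset.single_le_sum (f := fun i => (w.2 j i)^2) (fun _ _ => sq_nonneg _) (Finset.mem_univ i)
  have h2 : ∑ i, (w.2 j i)^2 ≤ ∑ j, ∑ i, (w.2 j i)^2 :=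
    Finset.single_le_sum (f := fun j => ∑ i, (w.2 j i)^2)
      (fun _ _ => Finset.sum_nonneg fun _ _ => sq_nonneg _) (Finset.mem_univ j)
  have h3 : 0 ≤ ∑ j, ∑ e, (w.1 j e)^2 := by positivity
  unfold nsq; linarith

lemma tendsto_of_nsq {ι : Type*} {F : Filter ι} (z : ι → E n l) (z₀ : E n l)
    (h : Tendsto (fun k => nsq (z k - z₀)) F (nhds 0)) : Tendsto z F (nhds z₀) := by
  have aux : ∀ (f : ι → ℝ) (a : ℝ), (∀ k, (f k - a)^2 ≤ nsq (z k - z₀)) →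
      Tendsto f F (nhds a) := by
    intro f a hf
    have h1 : Tendsto (fun k => (f k - a)^2) F (nhds 0) :=
      squeeze_zero (fun _ => sq_nonneg _) hf h
    have h2 : Tendsto (fun k => |f k - a|) F (nhds 0) := by
      have := (Real.continuous_sqrt.tendsto 0).comp h1
      simpa [Function.comp_def, Real.sqrt_sq_eq_abs] using this
    have h3 := (tendsto_zero_iff_abs_tendsto_zero _).2 h2
    simpa using h3.add_const a
  have h1 : Tendsto (fun k => (z k).1) F (nhds z₀.1) := by
    rw [tendsto_pi_nhds]; intro j; rw [tendsto_pi_nhds]; intro i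
    exact aux _ _ fun k => le_nsq1 (z k - z₀) j i
  have h2 : Tendsto (fun k => (z k).2) F (nhds z₀.2) := by
    rw [tendsto_pi_nhds]; intro j; rw [tendsto_pi_nhds]; intro i
    exact aux _ _ fun k => le_nsq2 (z k - z₀) j i
  exact h1.prodMk_nhds h2

lemma bounded_of_nsq (z₀ : E n l) (R : ℝ) : Bornology.IsBounded {z : E n l | nsq (z - z₀) ≤ R} := by
  rw [Metric.isBounded_iff_subset_closedBall z₀]
  refine ⟨Real.sqrt R, fun z hz => ?_⟩
  rw [Metric.mem_closedBall, dist_eq_norm]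
  have hz' : nsq (z - z₀) ≤ R := hz
  rw [Prod.norm_def]
  have aux : ∀ x : ℝ, x^2 ≤ nsq (z - z₀) → ‖x‖ ≤ Real.sqrt R := fun x hx =>
    Real.abs_le_sqrt (hx.trans hz')
  refine max_le ?_ ?_
  · refine (pi_norm_le_iff_of_nonneg (Real.sqrt_nonneg _)).2 fun j =>
      (pi_norm_le_iff_of_nonneg (Real.sqrt_nonneg _)).2 fun i => aux _ (le_nsq1 (z - z₀) j i)
  · refine (pi_norm_le_iff_of_nonneg (Real.sqrt_nonneg _)).2 fun j =>
      (pi_norm_le_iff_of_nonneg (Real.sqrt_nonneg _)).2 fun i => aux _ (le_nsq2 (z - z₀) j i)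

lemma anti_of_deriv {f f' : ℝ → ℝ} {T : ℝ} (hT : 0 ≤ T)
    (h : ∀ t ≥ (0:ℝ), HasDerivWithinAt f (f' t) (Set.Ici 0) t) (h' : ∀ t ≥ T, f' t ≤ 0) :
    AntitoneOn f (Set.Ici T) := by
  refine antitoneOn_of_hasDerivWithinAt_nonpos (f' := f') (convex_Ici T) ?_ ?_ ?_
  · intro t ht
    exact ((h t (hT.trans ht)).continuousWithinAt).mono (Set.Ici_subset_Ici.2 hT)
  · intro t ht
    rw [interior_Ici] at ht ⊢
    exact (h t (hT.trans (le_of_lt ht))).mono (fun s hs => hT.trans (le_of_lt hs))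
  · intro t ht
    rw [interior_Ici] at ht
    exact h' t (le_of_lt ht)

theorem traj_converges (N : Net n l) (zs : E n l) (hs : Dyn N zs 0) (z w : ℝ → E n l)
    (h1 : ∀ t ≥ (0:ℝ), ∀ j i, HasDerivWithinAt (fun t => (z t).1 j i) ((w t).1 j i) (Set.Ici 0) t)
    (h2 : ∀ t ≥ (0:ℝ), ∀ j i, HasDerivWithinAt (fun t => (z t).2 j i) ((w t).2 j i) (Set.Ici 0) t)
    (hd : ∀ t ≥ (0:ℝ), Dyn N (z t) (w t)) :
    ∃ z₀, Dyn N z₀ 0 ∧ Tendsto z atTop (nhds z₀) := by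
  obtain ⟨hκ0, hκ1⟩ := N.hκ
  set c : ℝ := 1 - (1+N.κ)^2/4 with hc
  have hc0 : 0 < c := by rw [hc]; nlinarith
  have hV := fun (y : E n l) (t : ℝ) (ht : t ≥ 0) =>
    V_deriv N y z (w t) (Set.Ici 0) t (h1 t ht) (h2 t ht)
  have hdec : ∀ y, Dyn N y 0 → ∀ t ≥ (0:ℝ),
      ∑ i, dVn N y (z t) (w t) i + ∑ e, dVe N y (z t) (w t) e ≤ -(c * nsq (w t)) :=
    fun y hy t ht => V_decay N y (z t) (w t) hy (hd t ht)
  have hanti : ∀ y, Dyn N y 0 → AntitoneOn (fun t => V N y (z t)) (Set.Ici 0) := fun y hy =>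
    anti_of_deriv le_rfl (hV y) fun t ht => (hdec y hy t ht).trans
      (by have := mul_nonneg hc0.le (nsq_nonneg (w t)); linarith)
  have hcoer : ∀ y z, N.κ/8 * nsq (z - y) ≤ V N y z := fun y z => V_coer N y z
  have hVnn : ∀ y z, 0 ≤ V N y z := fun y z =>
    le_trans (mul_nonneg (by linarith) (nsq_nonneg _)) (hcoer y z)
  -- velocities get small
  have hsmall : ∀ k : ℕ, ∃ t : ℝ, (k:ℝ) ≤ t ∧ nsq (w t) < 1 / ((k:ℝ) + 1) := by
    intro k
    by_contra hcon
    push Not at hcon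
    set ε : ℝ := 1 / ((k:ℝ)+1) with hε
    have hε0 : 0 < ε := by positivity
    have hk0 : (0:ℝ) ≤ k := by positivity
    have ha : AntitoneOn (fun t => V N zs (z t) + c * ε * t) (Set.Ici (k:ℝ)) := by
      refine anti_of_deriv (f' := fun t => (∑ i, dVn N zs (z t) (w t) i
        + ∑ e, dVe N zs (z t) (w t) e) + c * ε * 1) hk0 (fun t ht => ?_) (fun t ht => ?_)
      · exact (hV zs t ht).fun_add ((hasDerivWithinAt_id t _).const_mul (c * ε))
      · have a1 := hdec zs hs t (hk0.trans ht)
        have a2 := mul_le_mul_of_nonneg_left (hcon t ht) hc0.le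
        linarith
    have hcε : 0 < c * ε := mul_pos hc0 hε0
    set s : ℝ := (V N zs (z k) + 1) / (c * ε) with hs'
    have hs0 : 0 ≤ s := div_nonneg (by linarith [hVnn zs (z k)]) hcε.le
    have := ha (show (k:ℝ) ∈ Set.Ici (k:ℝ) by simp)
      (show (k:ℝ) + s ∈ Set.Ici (k:ℝ) from by simp [hs0]) (by linarith)
    simp only at this
    have e : c * ε * s = V N zs (z k) + 1 := by rw [hs']; field_simp
    have := hVnn zs (z (k + s))
    nlinarith
  choose τ hτ1 hτ2 using hsmall
  have hτ0 : ∀ k, 0 ≤ τ k := fun k => le_trans (by positivity) (hτ1 k)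
  have hbd : ∀ k, z (τ k) ∈ {y : E n l | nsq (y - zs) ≤ V N zs (z 0) / (N.κ/8)} := by
    intro k
    have a1 := hcoer zs (z (τ k))
    have a2 := hanti zs hs (show (0:ℝ) ∈ Set.Ici 0 by simp) (hτ0 k) (hτ0 k)
    simp only at a2
    show nsq (z (τ k) - zs) ≤ V N zs (z 0) / (N.κ/8)
    rw [le_div_iff₀ (by linarith)]
    linarith
  obtain ⟨z₀, -, φ, hφ, hlim⟩ := tendsto_subseq_of_bounded (bounded_of_nsq zs _) hbd
  have hwlim : Tendsto (fun k => w (τ (φ k))) atTop (nhds 0) := by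
    refine tendsto_of_nsq _ _ ?_
    simp only [sub_zero]
    have : Tendsto (fun k => nsq (w (τ k))) atTop (nhds 0) :=
      squeeze_zero (fun _ => nsq_nonneg _) (fun k => (hτ2 k).le)
        tendsto_one_div_add_atTop_nhds_zero_nat
    exact this.comp hφ.tendsto_atTop
  have hz₀ : Dyn N z₀ 0 := Dyn_closed N (fun k => z (τ (φ k))) (fun k => w (τ (φ k))) z₀ 0
    (fun k => hd _ (hτ0 _)) hlim hwlim
  refine ⟨z₀, hz₀, tendsto_of_nsq _ _ ?_⟩
  have hVlim : Tendsto (fun k => V N z₀ (z (τ (φ k)))) atTop (nhds 0) := by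
    have := ((V_cont N z₀).tendsto z₀).comp hlim
    rwa [V_self N z₀ hz₀] at this
  have hVt : Tendsto (fun t => V N z₀ (z t)) atTop (nhds 0) := by
    rw [Metric.tendsto_atTop]
    intro ε hε
    obtain ⟨k, hk⟩ := ((tendsto_order.1 hVlim).2 ε hε).exists
    refine ⟨τ (φ k), fun t ht => ?_⟩
    have := hanti z₀ hz₀ (hτ0 (φ k)) (show t ∈ Set.Ici 0 from (hτ0 _).trans ht) ht
    simp only at this
    rw [Real.dist_eq, sub_zero, abs_of_nonneg (hVnn _ _)]
    linarith
  have h3 : Tendsto (fun t => V N z₀ (z t) / (N.κ/8)) atTop (nhds 0) := by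
    simpa using hVt.div_const (N.κ/8)
  refine squeeze_zero (fun _ => nsq_nonneg _) (fun t => ?_) h3
  rw [le_div_iff₀ (by linarith)]
  linarith [hcoer z₀ (z t)]

end DPPD

namespace DPPD

variable {n l : ℕ}

def Fobj (N : Net n l) (d e : Fin n → ℝ) : ℝ := ∑ i, (N.f0 i (d i) + N.f2 i (e i))

lemma Fobj_cont (N : Net n l) : Continuous fun q : (Fin n → ℝ) × (Fin n → ℝ) => Fobj N q.1 q.2 := by
  have h5 : ∀ i, Continuous (N.f0 i) := fun i => (N.hf0 i).continuous
  have h6 := f2_cont N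
  unfold Fobj
  fun_prop

lemma f0_conv (N : Net n l) (i : Fin n) (x y a b : ℝ) (ha : 0 ≤ a) (hb : 0 ≤ b) (hab : a + b = 1) :
    N.f0 i (a * x + b * y) ≤ a * N.f0 i x + b * N.f0 i y := by
  have hβ := N.hβ
  have h1 := N.hsc i (a * x + b * y) x
  have h2 := N.hsc i (a * x + b * y) y
  obtain rfl : a = 1 - b := by linarith
  set m := (1 - b) * x + b * y with hm
  have h1' : N.f0 i m + deriv (N.f0 i) m * (x - m) ≤ N.f0 i x := by
    have : 0 ≤ N.β/2 * (x - m)^2 := by positivity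
    linarith
  have h2' : N.f0 i m + deriv (N.f0 i) m * (y - m) ≤ N.f0 i y := by
    have : 0 ≤ N.β/2 * (y - m)^2 := by positivity
    linarith
  have e1 := mul_le_mul_of_nonneg_left h1' ha
  have e2 := mul_le_mul_of_nonneg_left h2' hb
  have : (1-b) * (x - m) + b * (y - m) = 0 := by rw [hm]; ring
  have : deriv (N.f0 i) m * ((1-b) * (x - m) + b * (y - m)) = 0 := by rw [this, mul_zero]
  linarith

lemma Fobj_conv (N : Net n l) (d d' e e' : Fin n → ℝ) (a b : ℝ) (ha : 0 ≤ a) (hb : 0 ≤ b)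
    (hab : a + b = 1) :
    Fobj N (a • d + b • d') (a • e + b • e') ≤ a * Fobj N d e + b * Fobj N d' e' := by
  unfold Fobj
  rw [Finset.mul_sum, Finset.mul_sum, ← Finset.sum_add_distrib]
  refine Finset.sum_le_sum fun i _ => ?_
  have h1 := f0_conv N i (d i) (d' i) a b ha hb hab
  have h2 := (N.hf2 i).2 (Set.mem_univ (e i)) (Set.mem_univ (e' i)) ha hb hab
  simp only [smul_eq_mul, Pi.add_apply, Pi.smul_apply] at h1 h2 ⊢
  linarith

lemma exists_min (N : Net n l) (dt θt : Fin n → ℝ) (h1 : ∀ i, N.dlo i < dt i ∧ dt i < N.dhi i)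
    (h2 : N.Pin - dt - N.L *ᵥ θt = 0)
    (h3 : ∀ e, N.Plo e < (N.M *ᵥ θt) e ∧ (N.M *ᵥ θt) e < N.Phi e) :
    ∃ ds θs : Fin n → ℝ, (∀ i, ds i ∈ Set.Icc (N.dlo i) (N.dhi i)) ∧
      N.Pin - ds - N.L *ᵥ θs = 0 ∧
      (∀ e, N.Plo e ≤ (N.M *ᵥ θs) e ∧ (N.M *ᵥ θs) e ≤ N.Phi e) ∧
      ∀ d θ : Fin n → ℝ, (∀ i, d i ∈ Set.Icc (N.dlo i) (N.dhi i)) → N.Pin - d - N.L *ᵥ θ = 0 →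
        (∀ e, N.Plo e ≤ (N.M *ᵥ θ) e ∧ (N.M *ᵥ θ) e ≤ N.Phi e) → Fobj N ds ds ≤ Fobj N d d := by
  let K : Set ((Fin n → ℝ) × (Fin l → ℝ)) :=
    (Set.Icc N.dlo N.dhi ×ˢ Set.Icc N.Plo N.Phi) ∩
      ({q | N.Pin - q.1 - N.C *ᵥ q.2 = 0} ∩ {q | q.2 ∈ LinearMap.range N.M.mulVecLin})
  have hLC : ∀ θ, N.L *ᵥ θ = N.C *ᵥ (N.M *ᵥ θ) := fun θ => by rw [N.hL, mulVec_mulVec]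
  have hK : IsCompact K := by
    refine (isCompact_Icc.prod isCompact_Icc).inter_right (IsClosed.inter ?_ ?_)
    · refine isClosed_eq ?_ continuous_const
      have : Continuous fun q : (Fin n → ℝ) × (Fin l → ℝ) => N.C *ᵥ q.2 :=
        Continuous.matrix_mulVec continuous_const continuous_snd
      fun_prop
    · exact (Submodule.closed_of_finiteDimensional _).preimage continuous_snd
  have hmem : ∀ d θ : Fin n → ℝ, (∀ i, d i ∈ Set.Icc (N.dlo i) (N.dhi i)) →
      N.Pin - d - N.L *ᵥ θ = 0 →
      (∀ e, N.Plo e ≤ (N.M *ᵥ θ) e ∧ (N.M *ᵥ θ) e ≤ N.Phi e) → (d, N.M *ᵥ θ) ∈ K := by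
    intro d θ a b c
    refine ⟨⟨⟨fun i => (a i).1, fun i => (a i).2⟩, ⟨fun i => (c i).1, fun i => (c i).2⟩⟩, ?_, ?_⟩
    · show N.Pin - d - N.C *ᵥ (N.M *ᵥ θ) = 0
      rw [← hLC]; exact b
    · exact ⟨θ, rfl⟩
  have hne : K.Nonempty := ⟨_, hmem dt θt (fun i => ⟨(h1 i).1.le, (h1 i).2.le⟩) h2
    (fun e => ⟨(h3 e).1.le, (h3 e).2.le⟩)⟩
  have hcont : Continuous fun q : (Fin n → ℝ) × (Fin l → ℝ) => Fobj N q.1 q.1 :=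
    (Fobj_cont N).comp (continuous_fst.prodMk continuous_fst)
  obtain ⟨⟨ds, p⟩, ⟨⟨ha, hb⟩, hc, ⟨θs, hθ⟩⟩, hmin⟩ := hK.exists_isMinOn hne hcont.continuousOn
  have hθ' : N.M *ᵥ θs = p := hθ
  refine ⟨ds, θs, fun i => ⟨ha.1 i, ha.2 i⟩, ?_, fun e => ?_, fun d θ a b c => ?_⟩
  · rw [hLC, hθ']; exact hc
  · rw [hθ']; exact ⟨hb.1 e, hb.2 e⟩
  · exact hmin (hmem d θ a b c)

lemma dual_rep {k : ℕ} (φ : (Fin k → ℝ) →ₗ[ℝ] ℝ) : ∃ c : Fin k → ℝ, ∀ x, φ x = c ⬝ᵥ x := by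
  refine ⟨fun i => φ (Pi.single i 1), fun x => ?_⟩
  conv_lhs => rw [pi_eq_sum_univ' x]
  rw [map_sum]
  unfold dotProduct
  refine Finset.sum_congr rfl fun i _ => ?_
  rw [map_smul, smul_eq_mul, mul_comm]

/-- Perturbation space. -/
abbrev X (n l : ℕ) := ℝ × (Fin n → ℝ) × (Fin n → ℝ) × (Fin l → ℝ) × (Fin l → ℝ)

/-- Strict separation. -/
lemma separation (N : Net n l)
    (Fs : ℝ) (hFs : ∀ d θ : Fin n → ℝ, (∀ i, d i ∈ Set.Icc (N.dlo i) (N.dhi i)) →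
        N.Pin - d - N.L *ᵥ θ = 0 →
        (∀ e, N.Plo e ≤ (N.M *ᵥ θ) e ∧ (N.M *ᵥ θ) e ≤ N.Phi e) → Fs ≤ Fobj N d d) :
    ∃ (ρ : ℝ) (lam ζ : Fin n → ℝ) (α γ : Fin l → ℝ),
      ∀ (d e θ : Fin n → ℝ) (r : ℝ) (a b : Fin l → ℝ), (∀ i, N.dlo i < d i ∧ d i < N.dhi i) →
        Fobj N d e < Fs + r → (∀ j, N.Plo j - (N.M *ᵥ θ) j < a j) →
        (∀ j, (N.M *ᵥ θ) j - N.Phi j < b j) →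
        0 < ρ * r + lam ⬝ᵥ (N.Pin - d - N.L *ᵥ θ) + ζ ⬝ᵥ (d - e) + α ⬝ᵥ a + γ ⬝ᵥ b := by
  let A : (Fin n → ℝ) → Set (X n l) := fun θ =>
    {x | (∀ i, N.dlo i < (N.Pin - x.2.1 - N.L *ᵥ θ) i ∧ (N.Pin - x.2.1 - N.L *ᵥ θ) i < N.dhi i) ∧
      Fobj N (N.Pin - x.2.1 - N.L *ᵥ θ) (N.Pin - x.2.1 - N.L *ᵥ θ - x.2.2.1) < Fs + x.1 ∧
      (∀ j, N.Plo j - (N.M *ᵥ θ) j < x.2.2.2.1 j) ∧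
      (∀ j, (N.M *ᵥ θ) j - N.Phi j < x.2.2.2.2 j)}
  have hopen : IsOpen (⋃ θ, A θ) := by
    refine isOpen_iUnion fun θ => ?_
    have c1 : Continuous fun x : X n l => N.Pin - x.2.1 - N.L *ᵥ θ := by fun_prop
    have c2 : Continuous fun x : X n l => N.Pin - x.2.1 - N.L *ᵥ θ - x.2.2.1 := by fun_prop
    have c3 : Continuous fun x : X n l =>
        Fobj N (N.Pin - x.2.1 - N.L *ᵥ θ) (N.Pin - x.2.1 - N.L *ᵥ θ - x.2.2.1) :=
      (Fobj_cont N).comp (c1.prodMk c2)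
    have o1 : IsOpen {x : X n l | ∀ i, N.dlo i < (N.Pin - x.2.1 - N.L *ᵥ θ) i ∧
        (N.Pin - x.2.1 - N.L *ᵥ θ) i < N.dhi i} := by
      simp only [Set.ofPred_forall]
      refine isOpen_iInter_of_finite fun i => ?_
      exact (isOpen_lt continuous_const ((continuous_apply i).comp c1)).inter
        (isOpen_lt ((continuous_apply i).comp c1) continuous_const)
    have o2 : IsOpen {x : X n l | Fobj N (N.Pin - x.2.1 - N.L *ᵥ θ)
        (N.Pin - x.2.1 - N.L *ᵥ θ - x.2.2.1) < Fs + x.1} :=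
      isOpen_lt c3 (by fun_prop)
    have o3 : IsOpen {x : X n l | ∀ j, N.Plo j - (N.M *ᵥ θ) j < x.2.2.2.1 j} := by
      simp only [Set.ofPred_forall]
      exact isOpen_iInter_of_finite fun i => isOpen_lt continuous_const (by fun_prop)
    have o4 : IsOpen {x : X n l | ∀ j, (N.M *ᵥ θ) j - N.Phi j < x.2.2.2.2 j} := by
      simp only [Set.ofPred_forall]
      exact isOpen_iInter_of_finite fun i => isOpen_lt continuous_const (by fun_prop)
    exact o1.inter (o2.inter (o3.inter o4))
  have lt_comb : ∀ (a b x y x' y' : ℝ), 0 ≤ a → 0 ≤ b → a + b = 1 → x < x' → y < y' →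
      a * x + b * y < a * x' + b * y' := by
    intro a b x y x' y' ha hb hab hx hy
    rcases ha.eq_or_lt with h | h
    · subst h; have : b = 1 := by linarith
      subst this; linarith
    · have := mul_lt_mul_of_pos_left hx h
      have := mul_le_mul_of_nonneg_left hy.le hb
      linarith
  have hconv : Convex ℝ (⋃ θ, A θ) := by
    intro x hx y hy a b ha hb hab
    obtain ⟨θ, hx1, hx2, hx3, hx4⟩ := Set.mem_iUnion.1 hx
    obtain ⟨θ', hy1, hy2, hy3, hy4⟩ := Set.mem_iUnion.1 hy
    refine Set.mem_iUnion.2 ⟨a • θ + b • θ', ?_⟩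
    have hd : N.Pin - (a • x + b • y).2.1 - N.L *ᵥ (a • θ + b • θ') =
        a • (N.Pin - x.2.1 - N.L *ᵥ θ) + b • (N.Pin - y.2.1 - N.L *ᵥ θ') := by
      rw [mulVec_add, mulVec_smul, mulVec_smul]
      ext i
      simp only [Prod.snd_add, Prod.fst_add, Prod.smul_snd, Prod.smul_fst, Pi.add_apply,
        Pi.sub_apply, Pi.smul_apply, smul_eq_mul]
      linear_combination (-N.Pin i) * hab
    have he : N.Pin - (a • x + b • y).2.1 - N.L *ᵥ (a • θ + b • θ') - (a • x + b • y).2.2.1 =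
        a • (N.Pin - x.2.1 - N.L *ᵥ θ - x.2.2.1) + b • (N.Pin - y.2.1 - N.L *ᵥ θ' - y.2.2.1) := by
      rw [hd]
      ext i
      simp only [Prod.snd_add, Prod.fst_add, Prod.smul_snd, Prod.smul_fst, Pi.add_apply,
        Pi.sub_apply, Pi.smul_apply, smul_eq_mul]
      ring
    refine ⟨?_, ?_, ?_, ?_⟩
    · intro i
      rw [hd]
      have q1 := lt_comb a b _ _ _ _ ha hb hab (hx1 i).1 (hy1 i).1
      have q2 := lt_comb a b _ _ _ _ ha hb hab (hx1 i).2 (hy1 i).2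
      have e1 : a * N.dlo i + b * N.dlo i = N.dlo i := by rw [← add_mul, hab, one_mul]
      have e2 : a * N.dhi i + b * N.dhi i = N.dhi i := by rw [← add_mul, hab, one_mul]
      rw [e1] at q1; rw [e2] at q2
      exact ⟨q1, q2⟩
    · rw [he, hd]
      refine (Fobj_conv N _ _ _ _ a b ha hb hab).trans_lt ?_
      refine (lt_comb a b _ _ _ _ ha hb hab hx2 hy2).trans_eq ?_
      simp only [Prod.fst_add, Prod.smul_fst, smul_eq_mul]
      linear_combination Fs * hab
    · intro j
      have q1 := lt_comb a b _ _ _ _ ha hb hab (hx3 j) (hy3 j)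
      refine lt_of_eq_of_lt ?_ q1
      rw [mulVec_add, mulVec_smul, mulVec_smul]
      simp only [Pi.add_apply, Pi.smul_apply, smul_eq_mul]
      linear_combination (-N.Plo j) * hab
    · intro j
      have q1 := lt_comb a b _ _ _ _ ha hb hab (hx4 j) (hy4 j)
      refine lt_of_eq_of_lt ?_ q1
      rw [mulVec_add, mulVec_smul, mulVec_smul]
      simp only [Pi.add_apply, Pi.smul_apply, smul_eq_mul]
      linear_combination (N.Phi j) * hab
  have h0 : (0 : X n l) ∉ ⋃ θ, A θ := by
    intro hx
    obtain ⟨θ, hx1, hx2, hx3, hx4⟩ := Set.mem_iUnion.1 hx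
    simp only [Prod.snd_zero, Prod.fst_zero, sub_zero, Pi.zero_apply, add_zero] at hx1 hx2 hx3 hx4
    have := hFs (N.Pin - N.L *ᵥ θ) θ (fun i => ⟨(hx1 i).1.le, (hx1 i).2.le⟩) (by abel)
      (fun e => ⟨by linarith [hx3 e], by linarith [hx4 e]⟩)
    linarith
  obtain ⟨f, hf⟩ := geometric_hahn_banach_point_open hconv hopen h0
  obtain ⟨lam, hlam⟩ := dual_rep (k := n) (f.toLinearMap ∘ₗ
    (LinearMap.inr ℝ ℝ _ ∘ₗ LinearMap.inl ℝ (Fin n → ℝ) _))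
  obtain ⟨ζ, hζ⟩ := dual_rep (k := n) (f.toLinearMap ∘ₗ
    (LinearMap.inr ℝ ℝ _ ∘ₗ LinearMap.inr ℝ (Fin n → ℝ) _ ∘ₗ LinearMap.inl ℝ (Fin n → ℝ) _))
  obtain ⟨α, hα⟩ := dual_rep (k := l) (f.toLinearMap ∘ₗ
    (LinearMap.inr ℝ ℝ _ ∘ₗ LinearMap.inr ℝ (Fin n → ℝ) _ ∘ₗ LinearMap.inr ℝ (Fin n → ℝ) _ ∘ₗ
      LinearMap.inl ℝ (Fin l → ℝ) (Fin l → ℝ)))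
  obtain ⟨γ, hγ⟩ := dual_rep (k := l) (f.toLinearMap ∘ₗ
    (LinearMap.inr ℝ ℝ _ ∘ₗ LinearMap.inr ℝ (Fin n → ℝ) _ ∘ₗ LinearMap.inr ℝ (Fin n → ℝ) _ ∘ₗ
      LinearMap.inr ℝ (Fin l → ℝ) (Fin l → ℝ)))
  refine ⟨f (1, 0), lam, ζ, α, γ, fun d e θ r a b hd hF ha hb => ?_⟩
  have hx : ((r, N.Pin - d - N.L *ᵥ θ, d - e, a, b) : X n l) ∈ ⋃ θ, A θ := by
    refine Set.mem_iUnion.2 ⟨θ, ?_⟩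
    have e1 : N.Pin - (N.Pin - d - N.L *ᵥ θ) - N.L *ᵥ θ = d := by abel
    have e2 : d - (d - e) = e := by abel
    refine ⟨?_, ?_, ha, hb⟩
    · simp only [e1]; exact hd
    · simp only [e1, e2]; exact hF
  have := hf _ hx
  rw [map_zero] at this
  rw [← hlam, ← hζ, ← hα, ← hγ]
  have e : ((r, N.Pin - d - N.L *ᵥ θ, d - e, a, b) : X n l) = r • ((1, 0) : X n l) +
      (0, N.Pin - d - N.L *ᵥ θ, 0) + (0, 0, d - e, 0) + (0, 0, 0, a, 0) + (0, 0, 0, 0, b) := by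
    simp
  rw [e] at this
  simp only [map_add, map_smul, smul_eq_mul] at this
  rw [mul_comm]
  exact this

lemma coef_nonneg {c r0 T : ℝ} (h : ∀ r > r0, 0 < c * r + T) : 0 ≤ c := by
  by_contra hc
  push Not at hc
  have h1 := h (|r0| + 1 + |T| / (-c)) (by
    have : 0 ≤ |T| / (-c) := div_nonneg (abs_nonneg _) (by linarith)
    linarith [le_abs_self r0])
  have e : c * (|T| / (-c)) = -|T| := by
    have : c ≠ 0 := hc.ne
    field_simp
  have : c * (|r0| + 1) ≤ 0 := mul_nonpos_of_nonpos_of_nonneg hc.le (by positivity)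
  have := le_abs_self T
  nlinarith

lemma multipliers (N : Net n l) (dt θt : Fin n → ℝ) (h1 : ∀ i, N.dlo i < dt i ∧ dt i < N.dhi i)
    (h2 : N.Pin - dt - N.L *ᵥ θt = 0)
    (h3 : ∀ e, N.Plo e < (N.M *ᵥ θt) e ∧ (N.M *ᵥ θt) e < N.Phi e)
    (Fs : ℝ) (hFs : ∀ d θ : Fin n → ℝ, (∀ i, d i ∈ Set.Icc (N.dlo i) (N.dhi i)) →
        N.Pin - d - N.L *ᵥ θ = 0 →
        (∀ e, N.Plo e ≤ (N.M *ᵥ θ) e ∧ (N.M *ᵥ θ) e ≤ N.Phi e) → Fs ≤ Fobj N d d) :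
    ∃ (lam ζ : Fin n → ℝ) (α γ : Fin l → ℝ), (∀ j, 0 ≤ α j) ∧ (∀ j, 0 ≤ γ j) ∧
      ∀ (d e θ : Fin n → ℝ), (∀ i, d i ∈ Set.Icc (N.dlo i) (N.dhi i)) →
        0 ≤ (Fobj N d e - Fs) + lam ⬝ᵥ (N.Pin - d - N.L *ᵥ θ) + ζ ⬝ᵥ (d - e)
          + α ⬝ᵥ (N.Plo - N.M *ᵥ θ) + γ ⬝ᵥ (N.M *ᵥ θ - N.Phi) := by
  obtain ⟨ρ, lam, ζ, α, γ, H⟩ := separation N Fs hFs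
  have hρ0 : 0 ≤ ρ := by
    refine coef_nonneg (r0 := Fobj N dt dt - Fs) (T := lam ⬝ᵥ (N.Pin - dt - N.L *ᵥ θt)
      + ζ ⬝ᵥ (dt - dt) + α ⬝ᵥ (0 : Fin l → ℝ) + γ ⬝ᵥ (0 : Fin l → ℝ)) fun r hr => ?_
    have := H dt dt θt r 0 0 h1 (by linarith) (fun j => by simpa using (h3 j).1)
      (fun j => by simpa using (h3 j).2)
    linarith
  have hα0 : ∀ j, 0 ≤ α j := by
    intro j
    refine coef_nonneg (r0 := 0) (T := ρ * (Fobj N dt dt - Fs + 1)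
      + lam ⬝ᵥ (N.Pin - dt - N.L *ᵥ θt)
      + ζ ⬝ᵥ (dt - dt) + γ ⬝ᵥ (0 : Fin l → ℝ)) fun r hr => ?_
    have := H dt dt θt (Fobj N dt dt - Fs + 1) (Pi.single j r) 0 h1 (by linarith)
      (fun k => ?_) (fun j => by simpa using (h3 j).2)
    · rw [dotProduct_single] at this
      linarith
    · have : (0:ℝ) ≤ (Pi.single j r : Fin l → ℝ) k := by
        have : (0 : Fin l → ℝ) ≤ Pi.single j r := Pi.single_nonneg.2 (le_of_lt hr)
        exact this k
      linarith [(h3 k).1]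
  have hγ0 : ∀ j, 0 ≤ γ j := by
    intro j
    refine coef_nonneg (r0 := 0) (T := ρ * (Fobj N dt dt - Fs + 1)
      + lam ⬝ᵥ (N.Pin - dt - N.L *ᵥ θt)
      + ζ ⬝ᵥ (dt - dt) + α ⬝ᵥ (0 : Fin l → ℝ)) fun r hr => ?_
    have := H dt dt θt (Fobj N dt dt - Fs + 1) 0 (Pi.single j r) h1 (by linarith)
      (fun j => by simpa using (h3 j).1) (fun k => ?_)
    · rw [dotProduct_single] at this
      linarith
    · have : (0:ℝ) ≤ (Pi.single j r : Fin l → ℝ) k := by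
        have : (0 : Fin l → ℝ) ≤ Pi.single j r := Pi.single_nonneg.2 (le_of_lt hr)
        exact this k
      linarith [(h3 k).2]
  have hρ : 0 < ρ := by
    rcases hρ0.eq_or_lt with h | h
    swap
    · exact h
    exfalso
    -- a small perturbation of the Slater point
    have hev : ∀ᶠ s : ℝ in nhdsWithin 0 (Set.Ioi 0),
        ∀ i, N.dlo i < (dt + s • lam) i ∧ (dt + s • lam) i < N.dhi i := by
      rw [eventually_all]
      intro i
      have c : Continuous fun s : ℝ => (dt + s • lam) i := by
        simp only [Pi.add_apply, Pi.smul_apply]; fun_prop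
      have t : Tendsto (fun s : ℝ => (dt + s • lam) i) (nhdsWithin 0 (Set.Ioi 0)) (nhds (dt i)) := by
        have := (c.tendsto 0).mono_left (nhdsWithin_le_nhds (s := Set.Ioi 0))
        simpa using this
      exact (t.eventually_const_lt (h1 i).1).and (t.eventually_lt_const (h1 i).2)
    obtain ⟨s, hs, hs0⟩ := (hev.and self_mem_nhdsWithin).exists
    have hs0 : 0 < s := hs0
    have := H (dt + s • lam) (dt + s • lam) θt
      (Fobj N (dt + s • lam) (dt + s • lam) - Fs + 1)
      (fun j => (N.Plo j - (N.M *ᵥ θt) j)/2) (fun j => ((N.M *ᵥ θt) j - N.Phi j)/2) hs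
      (by linarith) (fun j => by linarith [(h3 j).1]) (fun j => by linarith [(h3 j).2])
    have e1 : N.Pin - (dt + s • lam) - N.L *ᵥ θt = -(s • lam) := by
      rw [← sub_sub, sub_right_comm, h2, zero_sub]
    rw [e1, ← h, sub_self, dotProduct_zero, dotProduct_neg, dotProduct_smul, smul_eq_mul] at this
    have p1 : 0 ≤ lam ⬝ᵥ lam := Finset.sum_nonneg fun i _ => mul_self_nonneg _
    have p2 : α ⬝ᵥ (fun j => (N.Plo j - (N.M *ᵥ θt) j)/2) ≤ 0 :=
      Finset.sum_nonpos fun j _ => mul_nonpos_of_nonneg_of_nonpos (hα0 j) (by linarith [(h3 j).1])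
    have p3 : γ ⬝ᵥ (fun j => ((N.M *ᵥ θt) j - N.Phi j)/2) ≤ 0 :=
      Finset.sum_nonpos fun j _ => mul_nonpos_of_nonneg_of_nonpos (hγ0 j) (by linarith [(h3 j).2])
    have := mul_nonneg hs0.le p1
    linarith
  refine ⟨ρ⁻¹ • lam, ρ⁻¹ • ζ, ρ⁻¹ • α, ρ⁻¹ • γ, fun j => mul_nonneg (by positivity) (hα0 j),
    fun j => mul_nonneg (by positivity) (hγ0 j), fun d e θ hd => ?_⟩
  have key : 0 ≤ ρ * (Fobj N d e - Fs) + lam ⬝ᵥ (N.Pin - d - N.L *ᵥ θ) + ζ ⬝ᵥ (d - e)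
          + α ⬝ᵥ (N.Plo - N.M *ᵥ θ) + γ ⬝ᵥ (N.M *ᵥ θ - N.Phi) := by
    let ds : ℝ → Fin n → ℝ := fun s => d + s • (dt - d)
    have cds : Continuous ds := by fun_prop
    have cF : Continuous fun s => Fobj N (ds s) e := (Fobj_cont N).comp (cds.prodMk continuous_const)
    let Φ : ℝ → ℝ := fun s => ρ * (Fobj N (ds s) e - Fs + s) + lam ⬝ᵥ (N.Pin - ds s - N.L *ᵥ θ)
      + ζ ⬝ᵥ (ds s - e) + α ⬝ᵥ (fun j => N.Plo j - (N.M *ᵥ θ) j + s)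
      + γ ⬝ᵥ (fun j => (N.M *ᵥ θ) j - N.Phi j + s)
    have cΦ : Continuous Φ := by
      have cds' : ∀ i, Continuous fun s => ds s i := fun i => (continuous_apply i).comp cds
      simp only [Φ, dotProduct, Pi.sub_apply]
      fun_prop
    have t : Tendsto Φ (nhdsWithin 0 (Set.Ioi 0)) (nhds (Φ 0)) :=
      (cΦ.tendsto 0).mono_left nhdsWithin_le_nhds
    have p : 0 ≤ Φ 0 := by
      refine ge_of_tendsto t ?_
      filter_upwards [Ioo_mem_nhdsGT (show (0:ℝ) < 1 by norm_num)] with s hs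
      obtain ⟨hs0, hs1⟩ := hs
      refine (H (ds s) e θ (Fobj N (ds s) e - Fs + s) _ _ (fun i => ?_) (by linarith)
        (fun j => by linarith) (fun j => by linarith)).le
      have a1 := hd i
      have a2 := h1 i
      have : ds s i = (1-s) * d i + s * dt i := by simp [ds]; ring
      rw [this]
      constructor
      · nlinarith [a1.1, a2.1, mul_pos hs0 (sub_pos.2 a2.1), mul_nonneg (sub_nonneg.2 hs1.le) (sub_nonneg.2 a1.1)]
      · nlinarith [a1.1, a2.1, mul_pos hs0 (sub_pos.2 a2.2), mul_nonneg (sub_nonneg.2 hs1.le) (sub_nonneg.2 a1.2)]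
    have e0 : ds 0 = d := by simp [ds]
    simp only [Φ, e0, add_zero] at p
    exact p
  have := mul_nonneg (inv_nonneg.2 hρ.le) key
  simp only [smul_dotProduct, smul_eq_mul]
  have e : ρ⁻¹ * (ρ * (Fobj N d e - Fs)) = Fobj N d e - Fs := by field_simp
  linarith

lemma max_compl {a x : ℝ} (ha : 0 ≤ a) (hx : x ≤ 0) (h : a * x = 0) : max 0 (a + x) = a := by
  rcases mul_eq_zero.1 h with h | h
  · subst h; simpa using hx
  · subst h; simpa using ha

theorem exists_equil (N : Net n l) (dt θt : Fin n → ℝ)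
    (h1 : ∀ i, N.dlo i < dt i ∧ dt i < N.dhi i)
    (h2 : N.Pin - dt - N.L *ᵥ θt = 0)
    (h3 : ∀ e, N.Plo e < (N.M *ᵥ θt) e ∧ (N.M *ᵥ θt) e < N.Phi e) :
    ∃ zs, Dyn N zs 0 := by
  obtain ⟨ds, θs, hds, heq, hbd, hmin⟩ := exists_min N dt θt h1 h2 h3
  obtain ⟨μ, ζ, α, γ, hα, hγ, H⟩ := multipliers N dt θt h1 h2 h3 (Fobj N ds ds) hmin
  have hκ := N.hκ.1
  have a0 : ∀ j, α j * (N.Plo j - (N.M *ᵥ θs) j) ≤ 0 := fun j =>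
    mul_nonpos_of_nonneg_of_nonpos (hα j) (by linarith [(hbd j).1])
  have g0 : ∀ j, γ j * ((N.M *ᵥ θs) j - N.Phi j) ≤ 0 := fun j =>
    mul_nonpos_of_nonneg_of_nonpos (hγ j) (by linarith [(hbd j).2])
  have H0 := H ds ds θs hds
  rw [heq, sub_self, sub_self, dotProduct_zero, dotProduct_zero] at H0
  have sa : α ⬝ᵥ (N.Plo - N.M *ᵥ θs) ≤ 0 := Finset.sum_nonpos fun j _ => a0 j
  have sg : γ ⬝ᵥ (N.M *ᵥ θs - N.Phi) ≤ 0 := Finset.sum_nonpos fun j _ => g0 j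
  have sa0 : α ⬝ᵥ (N.Plo - N.M *ᵥ θs) = 0 := by linarith
  have sg0 : γ ⬝ᵥ (N.M *ᵥ θs - N.Phi) = 0 := by linarith
  have ca : ∀ j, α j * (N.Plo j - (N.M *ᵥ θs) j) = 0 := fun j =>
    (Finset.sum_eq_zero_iff_of_nonpos fun j _ => a0 j).1 sa0 j (Finset.mem_univ j)
  have cg : ∀ j, γ j * ((N.M *ᵥ θs) j - N.Phi j) = 0 := fun j =>
    (Finset.sum_eq_zero_iff_of_nonpos fun j _ => g0 j).1 sg0 j (Finset.mem_univ j)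
  have adj : ∀ {a b : ℕ} (A : Matrix (Fin a) (Fin b) ℝ) (x : Fin a → ℝ) (y : Fin b → ℝ),
      x ⬝ᵥ (A *ᵥ y) = (Aᵀ *ᵥ x) ⬝ᵥ y := fun A x y => by
    rw [dotProduct_mulVec, mulVec_transpose]
  -- stationarity in θ
  have hstat : N.Mᵀ *ᵥ (α - γ) + N.L *ᵥ μ = 0 := by
    set y := N.Mᵀ *ᵥ (α - γ) + N.L *ᵥ μ with hy
    have Hy := H ds ds (θs + y) hds
    have e1 : N.Pin - ds - N.L *ᵥ (θs + y) = -(N.L *ᵥ y) := by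
      rw [mulVec_add, ← sub_sub, heq, zero_sub]
    have e2 : N.Plo - N.M *ᵥ (θs + y) = (N.Plo - N.M *ᵥ θs) - N.M *ᵥ y := by
      rw [mulVec_add, sub_sub]
    have e3 : N.M *ᵥ (θs + y) - N.Phi = (N.M *ᵥ θs - N.Phi) + N.M *ᵥ y := by
      rw [mulVec_add]; abel
    rw [e1, e2, e3, sub_self, sub_self, dotProduct_zero, dotProduct_neg, dotProduct_sub,
      dotProduct_add, sa0, sg0, adj, adj, adj, N.hLt] at Hy
    have e4 : y ⬝ᵥ y = (N.Mᵀ *ᵥ α) ⬝ᵥ y - (N.Mᵀ *ᵥ γ) ⬝ᵥ y + (N.L *ᵥ μ) ⬝ᵥ y := by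
      rw [← sub_dotProduct, ← mulVec_sub, ← add_dotProduct, ← hy]
    have e5 : 0 ≤ y ⬝ᵥ y := Finset.sum_nonneg fun i _ => mul_self_nonneg _
    exact dotProduct_self_eq_zero.1 (le_antisymm (by linarith) e5)
  -- separable inequality
  have Hsep : ∀ d e : Fin n → ℝ, (∀ i, d i ∈ Set.Icc (N.dlo i) (N.dhi i)) →
      0 ≤ ∑ i, (N.f0 i (d i) - N.f0 i (ds i) + (N.f2 i (e i) - N.f2 i (ds i))
        - μ i * (d i - ds i) + ζ i * (d i - e i)) := by
    intro d e hd
    have Hd := H d e θs hd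
    have e1 : N.Pin - d - N.L *ᵥ θs = -(d - ds) := by
      have : N.L *ᵥ θs = N.Pin - ds := (sub_eq_zero.1 heq).symm
      rw [this]; abel
    rw [e1, sa0, sg0] at Hd
    refine Hd.trans_eq ?_
    simp only [Fobj, dotProduct, Pi.neg_apply, Pi.sub_apply, Finset.sum_add_distrib,
      Finset.sum_sub_distrib, mul_neg, Finset.sum_neg_distrib]
    ring
  have Hi : ∀ i, ∀ x ∈ Set.Icc (N.dlo i) (N.dhi i), ∀ y,
      0 ≤ N.f0 i x - N.f0 i (ds i) + (N.f2 i y - N.f2 i (ds i))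
        - μ i * (x - ds i) + ζ i * (x - y) := by
    intro i x hx y
    have := Hsep (Function.update ds i x) (Function.update ds i y) (fun k => by
      by_cases hk : k = i
      · subst hk; simpa using hx
      · simpa [hk] using hds k)
    rw [Finset.sum_eq_single i (fun k _ hk => by simp [hk]) (by simp)] at this
    simpa using this
  have He : ∀ i y, N.f2 i (ds i) + ζ i * (y - ds i) ≤ N.f2 i y := by
    intro i y
    have := Hi i (ds i) (hds i) y
    linarith
  have Hd : ∀ i, ∀ y ∈ Set.Icc (N.dlo i) (N.dhi i),
      0 ≤ (deriv (N.f0 i) (ds i) + ζ i - μ i) * (y - ds i) := by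
    intro i y hy
    have c : Continuous fun s : ℝ =>
        (deriv (N.f0 i) (ds i + s * (y - ds i)) + ζ i - μ i) * (y - ds i) := by
      have := deriv_cont N i
      fun_prop
    have t := (c.tendsto 0).mono_left (nhdsWithin_le_nhds (s := Set.Ioi 0))
    simp only [zero_mul, add_zero] at t
    refine ge_of_tendsto t ?_
    filter_upwards [Ioo_mem_nhdsGT (show (0:ℝ) < 1 by norm_num)] with s hs
    obtain ⟨hs0, hs1⟩ := hs
    have hm : ds i + s * (y - ds i) ∈ Set.Icc (N.dlo i) (N.dhi i) := by
      have a1 := hds i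
      constructor
      · nlinarith [mul_nonneg hs0.le (sub_nonneg.2 hy.1), mul_nonneg (sub_nonneg.2 hs1.le) (sub_nonneg.2 a1.1)]
      · nlinarith [mul_nonneg hs0.le (sub_nonneg.2 hy.2), mul_nonneg (sub_nonneg.2 hs1.le) (sub_nonneg.2 a1.2)]
    have b1 := Hi i _ hm (ds i)
    have b2 := N.hsc i (ds i + s * (y - ds i)) (ds i)
    have b3 : 0 ≤ N.β / 2 * (ds i - (ds i + s * (y - ds i)))^2 := by
      have := N.hβ
      positivity
    have : 0 ≤ s * ((deriv (N.f0 i) (ds i + s * (y - ds i)) + ζ i - μ i) * (y - ds i)) := by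
      linarith
    exact nonneg_of_mul_nonneg_right this hs0
  -- the equilibrium
  let zs : E n l := (![fun i => -ζ i / N.κ, ds, θs, 0, μ], ![N.M *ᵥ θs, α, γ])
  have hu2 : u2 N zs = 0 := by
    ext i
    have := congrFun heq i
    simpa [u2, zs] using this
  have hu1 : u1 N zs = 0 := by
    ext i
    have := congrFun heq i
    rw [N.hL, ← mulVec_mulVec] at this
    simpa [u1, zs] using this
  have hpm : pm N zs = α := by
    ext j
    have := max_compl (hα j) (by linarith [(hbd j).1]) (ca j)
    rw [← this]
    simp [pm, zs, add_sub_assoc]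
  have hpp : pp N zs = γ := by
    ext j
    have := max_compl (hγ j) (by linarith [(hbd j).2]) (cg j)
    rw [← this]
    simp [pp, zs, add_sub_assoc]
  have hk : ∀ i, N.κ * (-ζ i / N.κ) = -ζ i := fun i => by field_simp
  refine ⟨zs, ?_⟩
  constructor
  · intro i x
    have := He i x
    simp only [zs, Prod.fst_zero, Pi.zero_apply, zero_add, sub_zero, neg_mul]
    simp only [Matrix.cons_val_zero, Matrix.cons_val_one, hk]
    simpa using this
  · intro i
    simpa [zs] using hds i
  · intro i y hy
    have := Hd i y hy
    rw [hu1, hu2]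
    simp only [zs, Prod.fst_zero, Pi.zero_apply, zero_add, sub_zero]
    simp [hk]
    linarith
  · intro i
    rw [hpm, hpp, hu2, add_zero]
    exact (congrFun hstat i).symm
  · intro i; rw [hu1]; simp
  · intro i; rw [hu2]; simp
  · intro e; rw [hu1]; simp [zs]
  · intro e; rw [hpm]; simp [zs]
  · intro e; rw [hpp]; simp [zs]

end DPPD

namespace DPPD
variable {n l : ℕ}

lemma compl_of_max {ν x : ℝ} (h : max 0 (ν + x) = ν) : 0 ≤ ν ∧ x ≤ 0 ∧ ν * x = 0 := by
  rcases max_cases 0 (ν + x) with ⟨h1, h2⟩ | ⟨h1, h2⟩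
  · have : ν = 0 := by linarith
    subst this
    exact ⟨le_refl _, by linarith, by ring⟩
  · have : x = 0 := by linarith
    subst this
    exact ⟨by linarith, le_refl _, by ring⟩

theorem equil_opt (N : Net n l) (z : E n l) (h : Dyn N z 0) (hω : z.1 3 = 0) :
    (∀ e, N.Plo e ≤ (N.M *ᵥ z.1 2) e ∧ (N.M *ᵥ z.1 2) e ≤ N.Phi e) ∧
    ∀ d' θ' : Fin n → ℝ, (∀ i, d' i ∈ Set.Icc (N.dlo i) (N.dhi i)) →
      (∀ i, N.Pin i - d' i - (N.L *ᵥ θ') i = 0) →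
      (∀ e, N.Plo e ≤ (N.M *ᵥ θ') e ∧ (N.M *ᵥ θ') e ≤ N.Phi e) →
      ∑ i, (N.f0 i (z.1 1 i) + N.f2 i (z.1 1 i)) ≤ ∑ i, (N.f0 i (d' i) + N.f2 i (d' i)) := by
  have hu1 : ∀ i, u1 N z i = 0 := fun i => by
    have := h.hω i; simp at this; linarith
  have hu2 : ∀ i, u2 N z i = 0 := fun i => by
    have := h.hμ i; simp at this; linarith
  have hu2' : u2 N z = 0 := funext hu2
  have hpm : ∀ e, pm N z e = z.2 1 e := fun e => by
    have := h.hm e; simp at this; linarith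
  have hpp : ∀ e, pp N z e = z.2 2 e := fun e => by
    have := h.hp e; simp at this; linarith
  have cm : ∀ e, _ := fun e => compl_of_max (ν := z.2 1 e) (x := N.Plo e - (N.M *ᵥ z.1 2) e)
    (by have := hpm e; unfold pm at this; rw [add_sub_assoc] at this; exact this)
  have cp : ∀ e, _ := fun e => compl_of_max (ν := z.2 2 e) (x := (N.M *ᵥ z.1 2) e - N.Phi e)
    (by have := hpp e; unfold pp at this; rw [add_sub_assoc] at this; exact this)
  refine ⟨fun e => ⟨by linarith [(cm e).2.1], by linarith [(cp e).2.1]⟩, ?_⟩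
  intro d' θ' hd' hb hl'
  have key : ∀ i, z.1 4 i * (d' i - z.1 1 i) ≤
      (N.f0 i (d' i) + N.f2 i (d' i)) - (N.f0 i (z.1 1 i) + N.f2 i (z.1 1 i)) := by
    intro i
    have a1 := N.hsc i (z.1 1 i) (d' i)
    have a2 := h.hη i (d' i)
    have a3 := h.hd i (d' i) (hd' i)
    have a4 : 0 ≤ N.β / 2 * (d' i - z.1 1 i) ^ 2 :=
      mul_nonneg (by linarith [N.hβ]) (sq_nonneg _)
    rw [hu1, hu2, hω] at a3
    simp at a2 a3
    nlinarith
  have hsum : 0 ≤ ∑ i, z.1 4 i * (d' i - z.1 1 i) := by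
    have e1 : ∀ i, d' i - z.1 1 i = - (N.L *ᵥ (θ' - z.1 2)) i := by
      intro i
      have b1 := hb i
      have b2 := hu2 i
      unfold u2 at b2
      rw [mulVec_sub, Pi.sub_apply]; linarith
    have e2 : N.Mᵀ *ᵥ (z.2 1 - z.2 2) + N.L *ᵥ z.1 4 = 0 := by
      ext i
      have := h.hθ i
      rw [hu2', add_zero, show pm N z = z.2 1 from funext hpm,
        show pp N z = z.2 2 from funext hpp] at this
      simpa using this.symm
    have e3 : ∑ i, z.1 4 i * (d' i - z.1 1 i) = - (z.1 4 ⬝ᵥ N.L *ᵥ (θ' - z.1 2)) := by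
      simp only [dotProduct, ← Finset.sum_neg_distrib]
      exact Finset.sum_congr rfl fun i _ => by rw [e1]; ring
    have e4 : z.1 4 ⬝ᵥ N.L *ᵥ (θ' - z.1 2) = - ((z.2 1 - z.2 2) ⬝ᵥ N.M *ᵥ (θ' - z.1 2)) := by
      rw [dotProduct_mulVec, dotProduct_mulVec, ← mulVec_transpose, ← mulVec_transpose, N.hLt,
        ← neg_dotProduct, eq_neg_of_add_eq_zero_right e2]
    rw [e3, e4, neg_neg]
    refine Finset.sum_nonneg fun e _ => ?_
    obtain ⟨m1, m2, m3⟩ := cm e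
    obtain ⟨p1, p2, p3⟩ := cp e
    have q := hl' e
    rw [mulVec_sub, Pi.sub_apply, Pi.sub_apply]
    have r1 := mul_nonneg m1 (sub_nonneg.2 q.1)
    have r2 := mul_nonneg p1 (sub_nonneg.2 q.2)
    nlinarith
  have := Finset.sum_le_sum fun i (_ : i ∈ Finset.univ) => key i
  rw [Finset.sum_sub_distrib] at this
  linarith

theorem equil_omega (N : Net n l) (hn : 0 < n) (hC1 : Matrix.vecMul (fun _ => (1:ℝ)) N.C = 0)
    (hker : ∀ x : Fin n → ℝ, N.Cᵀ *ᵥ x = 0 → ∃ c : ℝ, x = fun _ => c)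
    (z : E n l) (h : Dyn N z 0) : z.1 3 = 0 := by
  have hu1 : ∀ i, u1 N z i = 0 := fun i => by
    have := h.hω i; simp at this; linarith
  have hu2 : ∀ i, u2 N z i = 0 := fun i => by
    have := h.hμ i; simp at this; linarith
  have hk : N.Cᵀ *ᵥ z.1 3 = 0 := by
    ext e
    have := h.hP e
    rw [show u1 N z = 0 from funext hu1, add_zero] at this
    exact this.symm
  obtain ⟨c, hc⟩ := hker _ hk
  have s : ∀ i, N.Dg i * c = (N.C *ᵥ (N.M *ᵥ z.1 2 - z.2 0)) i := by
    intro i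
    have a := hu1 i
    have b := hu2 i
    unfold u1 at a
    unfold u2 at b
    rw [N.hL, ← mulVec_mulVec] at b
    rw [mulVec_sub, Pi.sub_apply]
    have : z.1 3 i = c := by rw [hc]
    rw [this] at a
    linarith
  have s2 : (∑ i, N.Dg i) * c = 0 := by
    rw [Finset.sum_mul, Finset.sum_congr rfl fun i _ => s i]
    have : (fun _ : Fin n => (1:ℝ)) ⬝ᵥ N.C *ᵥ (N.M *ᵥ z.1 2 - z.2 0) = 0 := by
      rw [dotProduct_mulVec, hC1, zero_dotProduct]
    simpa [dotProduct] using this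
  have s3 : 0 < ∑ i, N.Dg i :=
    Finset.sum_pos (fun i _ => N.hD i) ⟨⟨0, hn⟩, Finset.mem_univ _⟩
  rw [hc, (mul_eq_zero.1 s2).resolve_left s3.ne']
  rfl

end DPPD

/-- A continuously differentiable trajectory of the full DPPD dynamics
(with line-limit constraints), under Slater's condition and `d(0) ∈ Ω`, converges to an
equilibrium; at the limit `ω* = 0` and `(d*, θ̂*, ω*, P*)` is optimal for the ROLC
problem. -/
theorem dppd_full_trajectory_converges
    {n l : ℕ} (hn : 0 < n) (hl : 0 < l)
    (C : Matrix (Fin n) (Fin l) ℝ)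
    (hC1 : Matrix.vecMul (fun _ => (1:ℝ)) C = 0)
    (hker : ∀ x : Fin n → ℝ, Cᵀ.mulVec x = 0 ↔ ∃ c : ℝ, x = fun _ => c)
    (B : Matrix (Fin l) (Fin l) ℝ)
    (hBdiag : ∀ e f, e ≠ f → B e f = 0) (hBpos : ∀ e, 0 < B e e)
    (D : Matrix (Fin n) (Fin n) ℝ)
    (hDdiag : ∀ i j, i ≠ j → D i j = 0) (hDpos : ∀ i, 0 < D i i)
    (Pin : Fin n → ℝ)
    (dlo dhi : Fin n → ℝ) (hbox : ∀ i, dlo i ≤ dhi i)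
    (f0 : Fin n → ℝ → ℝ) (hf0diff : ∀ i, Differentiable ℝ (f0 i))
    (β : ℝ) (hβ : 1 < β)
    (hf0sc : ∀ (i : Fin n) (x y : ℝ),
      f0 i x + deriv (f0 i) x * (y - x) + β / 2 * (y - x) ^ 2 ≤ f0 i y)
    (f2 : Fin n → ℝ → ℝ) (hf2conv : ∀ i, ConvexOn ℝ Set.univ (f2 i))
    (Plo Phi : Fin l → ℝ)
    (κ : ℝ) (hκ : κ ∈ Set.Ioo (0:ℝ) 1)
    -- Slater's condition
    (hslater : ∃ (dt θt : Fin n → ℝ),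
      (∀ i, dlo i < dt i ∧ dt i < dhi i) ∧
      Pin - dt - (C * B * Cᵀ).mulVec θt = 0 ∧
      (∀ e, Plo e < B.mulVec (Cᵀ.mulVec θt) e ∧ B.mulVec (Cᵀ.mulVec θt) e < Phi e))
    -- the trajectory and its derivatives
    (η d ω μ θh : ℝ → Fin n → ℝ) (P νm νp : ℝ → Fin l → ℝ)
    (ηd dd ωd μd θhd : ℝ → Fin n → ℝ) (Pd νmd νpd : ℝ → Fin l → ℝ)
    (hηD : ∀ t ≥ (0:ℝ), HasDerivWithinAt η (ηd t) (Set.Ici 0) t)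
    (hdD : ∀ t ≥ (0:ℝ), HasDerivWithinAt d (dd t) (Set.Ici 0) t)
    (hωD : ∀ t ≥ (0:ℝ), HasDerivWithinAt ω (ωd t) (Set.Ici 0) t)
    (hμD : ∀ t ≥ (0:ℝ), HasDerivWithinAt μ (μd t) (Set.Ici 0) t)
    (hθD : ∀ t ≥ (0:ℝ), HasDerivWithinAt θh (θhd t) (Set.Ici 0) t)
    (hPD : ∀ t ≥ (0:ℝ), HasDerivWithinAt P (Pd t) (Set.Ici 0) t)
    (hνmD : ∀ t ≥ (0:ℝ), HasDerivWithinAt νm (νmd t) (Set.Ici 0) t)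
    (hνpD : ∀ t ≥ (0:ℝ), HasDerivWithinAt νp (νpd t) (Set.Ici 0) t)
    (hηC : ContinuousOn ηd (Set.Ici 0)) (hdC : ContinuousOn dd (Set.Ici 0))
    (hωC : ContinuousOn ωd (Set.Ici 0)) (hμC : ContinuousOn μd (Set.Ici 0))
    (hθC : ContinuousOn θhd (Set.Ici 0)) (hPC : ContinuousOn Pd (Set.Ici 0))
    (hνmC : ContinuousOn νmd (Set.Ici 0)) (hνpC : ContinuousOn νpd (Set.Ici 0))
    -- full DPPD dynamics, with u₁ = P^in − d − Dω − CP, u₂ = P^in − d − C B Cᵀ θ̂,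
    -- p⁻ = max(0, ν⁻ + P̲ − B Cᵀ θ̂), p⁺ = max(0, ν⁺ + B Cᵀ θ̂ − P̄)
    (hdynη : ∀ t ≥ (0:ℝ), ∀ i, IsMinOn
      (fun x : ℝ => f2 i x + (1 / 2) * (x - (d t i - κ * η t i)) ^ 2) Set.univ
      (ηd t i + d t i))
    (hdynd : ∀ t ≥ (0:ℝ), ∀ i, dd t i =
      max (dlo i) (min (dhi i)
        (d t i - deriv (f0 i) (d t i) + κ * η t i + ω t i
          + (Pin - d t - D.mulVec (ω t) - C.mulVec (P t)) i + μ t i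
          + (Pin - d t - (C * B * Cᵀ).mulVec (θh t)) i)) - d t i)
    (hdynθ : ∀ t ≥ (0:ℝ),
      θhd t = (C * B).mulVec
          ((fun e => max 0 (νm t e + Plo e - B.mulVec (Cᵀ.mulVec (θh t)) e))
            - fun e => max 0 (νp t e + B.mulVec (Cᵀ.mulVec (θh t)) e - Phi e))
        + (C * B * Cᵀ).mulVec (μ t + (Pin - d t - (C * B * Cᵀ).mulVec (θh t))))
    (hdynP : ∀ t ≥ (0:ℝ),
      Pd t = Cᵀ.mulVec (ω t + (Pin - d t - D.mulVec (ω t) - C.mulVec (P t))))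
    (hdynω : ∀ t ≥ (0:ℝ),
      ωd t = (1 / 2 : ℝ) • (Pin - d t - D.mulVec (ω t) - C.mulVec (P t)))
    (hdynμ : ∀ t ≥ (0:ℝ),
      μd t = (1 / 2 : ℝ) • (Pin - d t - (C * B * Cᵀ).mulVec (θh t)))
    (hdynνm : ∀ t ≥ (0:ℝ), ∀ e, νmd t e =
      (1 / 2 : ℝ) * (max 0 (νm t e + Plo e - B.mulVec (Cᵀ.mulVec (θh t)) e) - νm t e))
    (hdynνp : ∀ t ≥ (0:ℝ), ∀ e, νpd t e =
      (1 / 2 : ℝ) * (max 0 (νp t e + B.mulVec (Cᵀ.mulVec (θh t)) e - Phi e) - νp t e))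
    -- initial feasibility
    (hd0 : ∀ i, d 0 i ∈ Set.Icc (dlo i) (dhi i)) :
    ∃ (ηs ds θhs ωs μs : Fin n → ℝ) (Ps νms νps : Fin l → ℝ),
      -- convergence of the trajectory
      Tendsto η atTop (nhds ηs) ∧ Tendsto d atTop (nhds ds) ∧
      Tendsto θh atTop (nhds θhs) ∧ Tendsto P atTop (nhds Ps) ∧
      Tendsto ω atTop (nhds ωs) ∧ Tendsto μ atTop (nhds μs) ∧
      Tendsto νm atTop (nhds νms) ∧ Tendsto νp atTop (nhds νps) ∧
      -- the limit is an equilibrium: all right-hand sides vanish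
      (∀ i, IsMinOn
        (fun x : ℝ => f2 i x + (1 / 2) * (x - (ds i - κ * ηs i)) ^ 2) Set.univ (ds i)) ∧
      (∀ i, ds i =
        max (dlo i) (min (dhi i)
          (ds i - deriv (f0 i) (ds i) + κ * ηs i + ωs i
            + (Pin - ds - D.mulVec ωs - C.mulVec Ps) i + μs i
            + (Pin - ds - (C * B * Cᵀ).mulVec θhs) i))) ∧
      (C * B).mulVec
          ((fun e => max 0 (νms e + Plo e - B.mulVec (Cᵀ.mulVec θhs) e))
            - fun e => max 0 (νps e + B.mulVec (Cᵀ.mulVec θhs) e - Phi e))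
        + (C * B * Cᵀ).mulVec (μs + (Pin - ds - (C * B * Cᵀ).mulVec θhs)) = 0 ∧
      Cᵀ.mulVec (ωs + (Pin - ds - D.mulVec ωs - C.mulVec Ps)) = 0 ∧
      Pin - ds - D.mulVec ωs - C.mulVec Ps = 0 ∧
      Pin - ds - (C * B * Cᵀ).mulVec θhs = 0 ∧
      (∀ e, max 0 (νms e + Plo e - B.mulVec (Cᵀ.mulVec θhs) e) - νms e = 0) ∧
      (∀ e, max 0 (νps e + B.mulVec (Cᵀ.mulVec θhs) e - Phi e) - νps e = 0) ∧
      -- frequency restoration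
      ωs = 0 ∧
      -- optimality for the ROLC problem
      ((∀ i, ds i ∈ Set.Icc (dlo i) (dhi i)) ∧
        (∀ e, Plo e ≤ B.mulVec (Cᵀ.mulVec θhs) e ∧ B.mulVec (Cᵀ.mulVec θhs) e ≤ Phi e) ∧
        ∀ (d' θh' ω' : Fin n → ℝ) (P' : Fin l → ℝ),
          (∀ i, d' i ∈ Set.Icc (dlo i) (dhi i)) →
          Pin - d' - D.mulVec ω' - C.mulVec P' = 0 →
          Pin - d' - (C * B * Cᵀ).mulVec θh' = 0 →
          (∀ e, Plo e ≤ B.mulVec (Cᵀ.mulVec θh') e ∧ B.mulVec (Cᵀ.mulVec θh') e ≤ Phi e) →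
          (∑ i, (f0 i (ds i) + f2 i (ds i))) + (1 / 2) * (ωs ⬝ᵥ D.mulVec ωs) ≤
            (∑ i, (f0 i (d' i) + f2 i (d' i))) + (1 / 2) * (ω' ⬝ᵥ D.mulVec ω')) := by
  have hBt : Bᵀ = B := by
    ext e f
    rw [transpose_apply]
    by_cases h : e = f
    · rw [h]
    · rw [hBdiag e f h, hBdiag f e (Ne.symm h)]
  have hDv : ∀ (x : Fin n → ℝ) i, D.mulVec x i = D i i * x i := by
    intro x i
    rw [mulVec, dotProduct]
    refine Finset.sum_eq_single i (fun j _ hj => ?_) (fun h => absurd (Finset.mem_univ i) h)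
    rw [hDdiag i j (Ne.symm hj), zero_mul]
  have hMt : (B * Cᵀ)ᵀ = C * B := by rw [transpose_mul, transpose_transpose, hBt]
  have hMv : ∀ x : Fin n → ℝ, B.mulVec (Cᵀ.mulVec x) = (B * Cᵀ).mulVec x := fun x =>
    mulVec_mulVec x B Cᵀ
  let N : DPPD.Net n l :=
    { C := C, M := B * Cᵀ, L := C * B * Cᵀ, hL := Matrix.mul_assoc _ _ _
      hLt := by rw [transpose_mul, transpose_mul, transpose_transpose, hBt, Matrix.mul_assoc]
      Dg := fun i => D i i, hD := hDpos, Pin := Pin, dlo := dlo, dhi := dhi, f0 := f0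
      hf0 := hf0diff, β := β, hβ := hβ, hsc := hf0sc, f2 := f2, hf2 := hf2conv
      Plo := Plo, Phi := Phi, κ := κ, hκ := hκ }
  simp only [hMv, ← hMt] at hslater hdynθ hdynνm hdynνp ⊢
  obtain ⟨dt, θt, hs1, hs2, hs3⟩ := hslater
  rw [hMt] at hs2
  obtain ⟨zs, hzs⟩ := DPPD.exists_equil N dt θt hs1 hs2 hs3
  let z : ℝ → DPPD.E n l := fun t => (![η t, d t, θh t, ω t, μ t], ![P t, νm t, νp t])
  let w : ℝ → DPPD.E n l := fun t => (![ηd t, dd t, θhd t, ωd t, μd t], ![Pd t, νmd t, νpd t])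
  have hu1 : ∀ (z : DPPD.E n l), DPPD.u1 N z = Pin - z.1 1 - D.mulVec (z.1 3) - C.mulVec (z.2 0) := by
    intro z; ext i
    simp only [DPPD.u1, Pi.sub_apply, hDv, N]
  have hu2 : ∀ (z : DPPD.E n l), DPPD.u2 N z = Pin - z.1 1 - (C * B * Cᵀ).mulVec (z.1 2) := by
    intro z; ext i
    simp only [DPPD.u2, Pi.sub_apply, N]
  have hdyn : ∀ t ≥ (0:ℝ), DPPD.Dyn N (z t) (w t) := by
    intro t ht
    have z1 : DPPD.u1 N (z t) = Pin - d t - D.mulVec (ω t) - C.mulVec (P t) := hu1 _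
    have z2 : DPPD.u2 N (z t) = Pin - d t - (C * B * Cᵀ).mulVec (θh t) := hu2 _
    have hcl := fun i => (DPPD.clamp_iff (hbox i)).1
      (show dd t i + d t i = _ from eq_sub_iff_add_eq.1 (hdynd t ht i))
    refine ⟨fun i x => ?_, fun i => (hcl i).1, fun i y hy => ?_, fun i => ?_, fun i => ?_,
      fun i => ?_, fun e => ?_, fun e => ?_, fun e => ?_⟩
    · have := (DPPD.prox_iff (hf2conv i) _ _).1 (hdynη t ht i) x
      refine le_trans (le_of_eq ?_) this
      change f2 i (ηd t i + d t i) + (-κ * η t i - ηd t i) * (x - (ηd t i + d t i)) = _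
      ring
    · have := (hcl i).2 y hy
      refine le_trans (le_of_eq ?_) this
      rw [z1, z2]
      change (dd t i + deriv (f0 i) (d t i) - κ * η t i - ω t i - _ - μ t i - _)
        * (dd t i + d t i - y) = _
      ring
    · have := congrFun (hdynθ t ht) i
      rw [z2]
      rw [hMt] at this
      change θhd t i = ((B * Cᵀ)ᵀ *ᵥ _) i + _
      rw [hMt]
      exact this
    · rw [z1]
      exact congrFun (hdynω t ht) i
    · rw [z2]
      exact congrFun (hdynμ t ht) i
    · rw [z1]
      exact congrFun (hdynP t ht) e
    · exact hdynνm t ht e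
    · exact hdynνp t ht e
  obtain ⟨z₀, hz₀, hlim⟩ := DPPD.traj_converges N zs hzs z w
    (by
      intro t ht j i
      fin_cases j
      · exact hasDerivWithinAt_pi.1 (hηD t ht) i
      · exact hasDerivWithinAt_pi.1 (hdD t ht) i
      · exact hasDerivWithinAt_pi.1 (hθD t ht) i
      · exact hasDerivWithinAt_pi.1 (hωD t ht) i
      · exact hasDerivWithinAt_pi.1 (hμD t ht) i)
    (by
      intro t ht j i
      fin_cases j
      · exact hasDerivWithinAt_pi.1 (hPD t ht) i
      · exact hasDerivWithinAt_pi.1 (hνmD t ht) i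
      · exact hasDerivWithinAt_pi.1 (hνpD t ht) i)
    hdyn
  have hl1 := fun j => tendsto_pi_nhds.1 ((Prod.tendsto_iff _ _).1 hlim).1 j
  have hl2 := fun j => tendsto_pi_nhds.1 ((Prod.tendsto_iff _ _).1 hlim).2 j
  have hω0 := DPPD.equil_omega N hn hC1 (fun x hx => (hker x).1 hx) z₀ hz₀
  obtain ⟨hlb, hopt⟩ := DPPD.equil_opt N z₀ hz₀ hω0
  have q1 : DPPD.u1 N z₀ = 0 := funext fun i => by
    have := hz₀.hω i
    have h' : (0:ℝ) = 1 / 2 * DPPD.u1 N z₀ i := this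
    rw [Pi.zero_apply]; linarith
  have q2 : DPPD.u2 N z₀ = 0 := funext fun i => by
    have := hz₀.hμ i
    have h' : (0:ℝ) = 1 / 2 * DPPD.u2 N z₀ i := this
    rw [Pi.zero_apply]; linarith
  have r1 := q1
  have r2 := q2
  rw [hu1] at r1
  rw [hu2] at r2
  have hdm : ∀ i, z₀.1 1 i ∈ Set.Icc (dlo i) (dhi i) := fun i => by
    have h' : (0:ℝ) + z₀.1 1 i ∈ Set.Icc (dlo i) (dhi i) := hz₀.hdm i
    rwa [zero_add] at h'
  refine ⟨z₀.1 0, z₀.1 1, z₀.1 2, z₀.1 3, z₀.1 4, z₀.2 0, z₀.2 1, z₀.2 2,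
    hl1 0, hl1 1, hl1 2, hl2 0, hl1 3, hl1 4, hl2 1, hl2 2, fun i => ?_, fun i => ?_, ?_, ?_,
    r1, ?_, fun e => ?_, fun e => ?_, hω0, hdm, hlb, ?_⟩
  · refine (DPPD.prox_iff (hf2conv i) _ _).2 fun x => ?_
    have h' : f2 i (0 + z₀.1 1 i) + (-κ * z₀.1 0 i - 0) * (x - (0 + z₀.1 1 i)) ≤ f2 i x :=
      hz₀.hη i x
    rw [zero_add] at h'
    linarith
  · refine (DPPD.clamp_iff (hbox i)).2 ⟨hdm i, fun y hy => ?_⟩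
    have h' : (0 + deriv (f0 i) (z₀.1 1 i) - κ * z₀.1 0 i - z₀.1 3 i - DPPD.u1 N z₀ i - z₀.1 4 i
        - DPPD.u2 N z₀ i) * (0 + z₀.1 1 i - y) ≤ 0 := hz₀.hd i y hy
    rw [hu1, hu2] at h'
    refine le_trans (le_of_eq ?_) h'
    try rw [hMt]
    ring
  · ext i
    have h' : (0:ℝ) = ((B * Cᵀ)ᵀ *ᵥ (DPPD.pm N z₀ - DPPD.pp N z₀)) i
      + ((C * B * Cᵀ) *ᵥ (z₀.1 4 + DPPD.u2 N z₀)) i := hz₀.hθ i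
    rw [hu2] at h'
    try rw [hMt]
    rw [hMt] at h'
    exact h'.symm
  · ext e
    have h' : (0:ℝ) = (Cᵀ *ᵥ (z₀.1 3 + DPPD.u1 N z₀)) e := hz₀.hP e
    rw [hu1] at h'
    exact h'.symm
  · try rw [hMt]
    exact r2
  · have h' : (0:ℝ) = 1 / 2 * (DPPD.pm N z₀ e - z₀.2 1 e) := hz₀.hm e
    change DPPD.pm N z₀ e - z₀.2 1 e = 0
    linarith
  · have h' : (0:ℝ) = 1 / 2 * (DPPD.pp N z₀ e - z₀.2 2 e) := hz₀.hp e
    change DPPD.pp N z₀ e - z₀.2 2 e = 0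
    linarith
  · intro d' θ' ω' P' hd' _ h2 h3
    try rw [hMt] at h2
    have := hopt d' θ' hd' (fun i => congrFun h2 i) h3
    have h4 : 0 ≤ ω' ⬝ᵥ D.mulVec ω' := by
      refine Finset.sum_nonneg fun i _ => ?_
      rw [hDv]
      nlinarith [mul_nonneg (hDpos i).le (mul_self_nonneg (ω' i))]
    have h5 : z₀.1 3 ⬝ᵥ D.mulVec (z₀.1 3) = 0 := by rw [hω0, zero_dotProduct]
    rw [h5]
    have h6 : (∑ i, (f0 i (z₀.1 1 i) + f2 i (z₀.1 1 i))) ≤ ∑ i, (f0 i (d' i) + f2 i (d' i)) := this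
    linarith
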